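/- arXiv:1412.6387 — 5 statements merged into one kernel-verified Lean document; each statement's English description precedes it below -/
import Mathlib

section
/- Let γ₁ : [0, T/2] → ℝ² and γ₂ : [0, T] → ℝ² be Lipschitz curves satisfying γ₁'(t) = b(γ₁(t)) for a.e. t ∈ [0, T/2] and γ₂'(t) = b(γ₂(t)) for a.e. t ∈ [0, T], where b : ℝ² → ℝ² is Borel. Assume γ₁ is injective and γ₂([0,T]) ⊆ γ₁([0, T/2]). Then the Lebesgue measure of { t ∈ [0,T] : γ₂'(t) = 0 } is at least T/2. -/
open MeasureTheory Set Metric Filter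

local notation "E2" => EuclideanSpace ℝ (Fin 2)

open scoped Topology

section Curves

variable {E : Type*} [NormedAddCommGroup E] [NormedSpace ℝ E]

/-- A set of times on which a curve has nonzero velocity is Lebesgue null as soon as its image is
null for the one-dimensional Hausdorff measure. -/
theorem volume_eq_zero_of_hausdorffMeasure_image_eq_zero [MeasurableSpace E] [BorelSpace E]
    {g : ℝ → E} {A : Set ℝ} (hA : ∀ t ∈ A, ∃ v, v ≠ 0 ∧ HasDerivAt g v t)
    (hg : μH[1] (g '' A) = 0) : volume A = 0 := by
  set P : ℕ → Set ℝ := fun n =>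
    {x ∈ A | ∀ y, dist y x < 1 / (n + 1 : ℝ) → dist y x ≤ (n + 1 : ℝ) * dist (g y) (g x)}
  have hcover : A ⊆ ⋃ n, P n := by
    intro x hx
    obtain ⟨v, hv, hd⟩ := hA x hx
    have hO : (fun y => y - x) =O[𝓝 x] fun y => g y - g x := by
      have h := (HasDerivAtFilter.isTheta_sub hd hv).isBigO_symm
      simpa [Asymptotics.isBigO_iff] using h
    obtain ⟨c, hc⟩ := hO.bound
    obtain ⟨ε, hε, hball⟩ := Metric.eventually_nhds_iff.1 hc
    obtain ⟨m, hm⟩ := exists_nat_gt c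
    obtain ⟨k, hk⟩ := exists_nat_one_div_lt hε
    refine mem_iUnion.2 ⟨max m k, hx, fun y hy => ?_⟩
    have hmk : (k : ℝ) ≤ (max m k : ℕ) := by exact_mod_cast le_max_right m k
    have hmm : (m : ℝ) ≤ (max m k : ℕ) := by exact_mod_cast le_max_left m k
    have hyε : dist y x < ε := by
      refine hy.trans_le (le_trans ?_ hk.le)
      gcongr
    have h := hball hyε
    rw [← dist_eq_norm, ← dist_eq_norm] at h
    refine h.trans ?_
    gcongr
    linarith
  refine measure_mono_null hcover (measure_iUnion_null fun n => ?_)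
  refine measure_null_of_locally_null _ fun x _ => ?_
  have hn : (0 : ℝ) < n + 1 := by positivity
  refine ⟨P n ∩ ball x (1 / (2 * (n + 1 : ℝ))),
    inter_mem self_mem_nhdsWithin (mem_nhdsWithin_of_mem_nhds (ball_mem_nhds _ (by positivity))), ?_⟩
  set Q := P n ∩ ball x (1 / (2 * (n + 1 : ℝ)))
  have hanti : AntilipschitzWith (n + 1 : NNReal) (Q.domRestrict g) := by
    refine AntilipschitzWith.of_le_mul_dist fun y z => ?_
    have hyz : dist (y : ℝ) z < 1 / (n + 1 : ℝ) := by
      have h1 := mem_ball.1 y.2.2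
      have h2 := mem_ball.1 z.2.2
      have h3 := dist_triangle_right (y : ℝ) z x
      have h4 : 1 / (2 * (n + 1 : ℝ)) + 1 / (2 * (n + 1 : ℝ)) = 1 / (n + 1 : ℝ) := by
        field_simp; norm_num
      linarith
    exact z.2.1.2 y hyz
  have himage : Q.domRestrict g '' univ ⊆ g '' A := by
    rintro _ ⟨y, -, rfl⟩
    exact ⟨y, y.2.1.1, rfl⟩
  have huniv : μH[1] (univ : Set Q) = 0 := by
    have h := hanti.le_hausdorffMeasure_image zero_le_one univ
    rw [measure_mono_null himage hg, mul_zero] at h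
    exact le_antisymm h bot_le
  have hQ : μH[1] Q = 0 := by
    have h := (isometry_subtype_coe (s := Q)).hausdorffMeasure_image (Or.inl zero_le_one) univ
    rwa [image_univ, Subtype.range_coe, huniv] at h
  rwa [hausdorffMeasure_real] at hQ

/-- If the points of `A`, at which `g` has nonzero velocity, are sent by `g` into the image of a
null set under a Lipschitz curve, then `A` is null. -/
theorem volume_eq_zero_of_image_subset_image {f g : ℝ → E} {A N S : Set ℝ} {K : NNReal}
    (hf : LipschitzOnWith K f S) (hNS : N ⊆ S) (hN : volume N = 0)
    (hA : ∀ t ∈ A, ∃ v, v ≠ 0 ∧ HasDerivAt g v t) (hsub : g '' A ⊆ f '' N) : volume A = 0 := by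
  borelize E
  refine volume_eq_zero_of_hausdorffMeasure_image_eq_zero hA (measure_mono_null hsub ?_)
  have h := (hf.mono hNS).hausdorffMeasure_image_le zero_le_one
  rw [hausdorffMeasure_real, hN, mul_zero] at h
  exact le_antisymm h bot_le

/-- If `f ∘ φ = g` near `t` and both `f` and `g` have the same nonzero velocity at `φ t` and `t`
respectively, then the continuous change of parameter `φ` has derivative `1` at `t`. -/
theorem hasDerivAt_one_of_comp_eq {f g : ℝ → E} {φ : ℝ → ℝ} {t : ℝ} {v : E} (hv : v ≠ 0)
    (hf : HasDerivAt f v (φ t)) (hg : HasDerivAt g v t) (hφ : ContinuousAt φ t)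
    (hfg : ∀ᶠ s in 𝓝 t, f (φ s) = g s) : HasDerivAt φ 1 t := by
  have ht : f (φ t) = g t := hfg.self_of_nhds
  have hO : (fun s => φ s - φ t) =O[𝓝 t] fun s => s - t := by
    have h1 : (fun y => y - φ t) =O[𝓝 (φ t)] fun y => f y - f (φ t) := by
      have h := (HasDerivAtFilter.isTheta_sub hf hv).isBigO_symm
      simpa [Asymptotics.isBigO_iff] using h
    have h2 : (fun s => φ s - φ t) =O[𝓝 t] fun s => f (φ s) - f (φ t) := h1.comp_tendsto hφ
    have h3 : (fun s => f (φ s) - f (φ t)) =ᶠ[𝓝 t] fun s => g s - g t := by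
      filter_upwards [hfg] with s hs
      rw [hs, ht]
    exact (h2.trans_eventuallyEq h3).trans hg.isBigO_sub
  have h1 := ((hasDerivAt_iff_isLittleO.1 hf).comp_tendsto hφ).trans_isBigO hO
  have h2 := (hasDerivAt_iff_isLittleO.1 hg).sub h1
  rw [hasDerivAt_iff_isLittleO]
  have h3 : (fun s => (φ s - φ t - (s - t) • (1 : ℝ)) • v) =o[𝓝 t] fun s => s - t := by
    refine h2.congr' ?_ EventuallyEq.rfl
    filter_upwards [hfg] with s hs
    simp only [Function.comp_apply, hs, ht, smul_eq_mul, mul_one, sub_smul]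
    abel
  refine (Asymptotics.IsBigO.of_bound ‖v‖⁻¹ (Eventually.of_forall fun s => ?_)).trans_isLittleO h3
  rw [norm_smul]
  field_simp [norm_ne_zero_iff.2 hv]
  exact le_rfl

/-- A continuous function that has positive derivative whenever it takes the value `u` takes this
value at most once. -/
theorem eq_of_forall_hasDerivAt_pos {φ : ℝ → ℝ} {a b u : ℝ} (hab : a ≤ b)
    (hφ : ContinuousOn φ (Icc a b)) (ha : φ a = u) (hb : φ b = u)
    (hd : ∀ t ∈ Icc a b, φ t = u → ∃ d, 0 < d ∧ HasDerivAt φ d t) : a = b := by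
  by_contra hne
  have hlt : a < b := lt_of_le_of_ne hab hne
  have hge : Icc a b ⊆ {t | u ≤ φ t} := by
    refine IsClosed.Icc_subset_of_forall_exists_gt ?_ ha.ge ?_
    · rw [inter_comm]
      exact hφ.preimage_isClosed_of_isClosed isClosed_Icc isClosed_Ici
    · rintro x ⟨hxu, hx⟩ y hy
      have hev : ∀ᶠ z in 𝓝[>] x, u ≤ φ z := by
        rcases (show u ≤ φ x from hxu).lt_or_eq with h | h
        · have hc : ContinuousWithinAt φ (Ioi x) x :=
            ((hφ x (Ico_subset_Icc_self hx)).mono_of_mem_nhdsWithin (Icc_mem_nhdsGT_of_mem hx))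
          exact (hc.eventually (lt_mem_nhds h)).mono fun z hz => hz.le
        · obtain ⟨d, hd0, hdx⟩ := hd x (Ico_subset_Icc_self hx) h.symm
          have hs := (hasDerivWithinAt_iff_tendsto_slope' (self_notMem_Ioi)).1
            (hdx.hasDerivWithinAt (s := Ioi x))
          filter_upwards [hs.eventually (lt_mem_nhds hd0), self_mem_nhdsWithin] with z hz hxz
          have hxz' : x < z := hxz
          rw [slope_def_field, div_pos_iff_of_pos_right (by linarith)] at hz
          linarith
      obtain ⟨z, hz1, hz2⟩ := (hev.and (Ioc_mem_nhdsGT hy)).exists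
      exact ⟨z, hz1, hz2⟩
  obtain ⟨d, hd0, hdb⟩ := hd b (right_mem_Icc.2 hab) hb
  have hs := (hasDerivWithinAt_iff_tendsto_slope' (self_notMem_Iio)).1
    (hdb.hasDerivWithinAt (s := Iio b))
  obtain ⟨z, hz1, hz2⟩ := ((hs.eventually (lt_mem_nhds hd0)).and (Ioo_mem_nhdsLT hlt)).exists
  have hzu : u ≤ φ z := hge ⟨hz2.1.le, hz2.2.le⟩
  rw [slope_def_field] at hz1
  have := div_nonpos_of_nonneg_of_nonpos (a := φ z - φ b) (b := z - b)
    (by linarith) (by linarith [hz2.2])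
  linarith

end Curves

/-- A change of parameter between a continuous curve and a continuous injective curve on a compact
set is continuous. -/
theorem continuousOn_of_comp_eqOn {X : Type*} [TopologicalSpace X] [T2Space X] {f g : ℝ → X}
    {φ : ℝ → ℝ} {S S' : Set ℝ} (hS' : IsCompact S') (hf : ContinuousOn f S') (hinj : InjOn f S')
    (hg : ContinuousOn g S) (hφ : MapsTo φ S S')
    (hfg : EqOn (f ∘ φ) g S) : ContinuousOn φ S := by
  have : CompactSpace S' := isCompact_iff_compactSpace.1 hS'
  have hemb : Topology.IsClosedEmbedding (S'.domRestrict f) :=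
    hf.domRestrict.isClosedEmbedding hinj.injective
  have hcont : Continuous (hφ.restrict φ S S') := by
    rw [hemb.isInducing.continuous_iff]
    convert hg.domRestrict using 1
    ext x
    exact hfg x.2
  rw [continuousOn_iff_continuous_domRestrict]
  exact continuous_subtype_val.comp hcont

/-- If `γ₁ : [0,T/2] → ℝ²` and `γ₂ : [0,T] → ℝ²` are Lipschitz integral
curves of a bounded Borel vector field `b`, `γ₁` is injective and the image of `γ₂` is
contained in the image of `γ₁`, then the set of times where `γ₂' = 0` has Lebesgue
measure at least `T/2`. -/
theorem stmt1 (T : ℝ) (hT : 0 < T)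
    (b : E2 → E2) (hb : Measurable b) (Cb : ℝ) (hbb : ∀ x, ‖b x‖ ≤ Cb)
    (γ₁ γ₂ : ℝ → E2) (K₁ K₂ : NNReal)
    (h₁ : LipschitzOnWith K₁ γ₁ (Set.Icc 0 (T/2)))
    (h₂ : LipschitzOnWith K₂ γ₂ (Set.Icc 0 T))
    (hode₁ : ∀ᵐ t ∂(volume.restrict (Set.Icc 0 (T/2))), HasDerivAt γ₁ (b (γ₁ t)) t)
    (hode₂ : ∀ᵐ t ∂(volume.restrict (Set.Icc 0 T)), HasDerivAt γ₂ (b (γ₂ t)) t)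
    (hinj : Set.InjOn γ₁ (Set.Icc 0 (T/2)))
    (himg : γ₂ '' Set.Icc 0 T ⊆ γ₁ '' Set.Icc 0 (T/2)) :
    ENNReal.ofReal (T/2) ≤ volume {t ∈ Set.Icc 0 T | HasDerivAt γ₂ 0 t} := by
  choose! φ hφmem hφ using fun t (ht : t ∈ Icc 0 T) => himg (mem_image_of_mem γ₂ ht)
  have hφc : ContinuousOn φ (Icc 0 T) :=
    continuousOn_of_comp_eqOn isCompact_Icc h₁.continuousOn hinj h₂.continuousOn hφmem hφ
  rw [ae_restrict_iff' measurableSet_Icc] at hode₁ hode₂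
  set N₁ : Set ℝ := {u ∈ Icc 0 (T / 2) | ¬ HasDerivAt γ₁ (b (γ₁ u)) u}
  set N₂ : Set ℝ := {t ∈ Icc 0 T | ¬ (HasDerivAt γ₂ (b (γ₂ t)) t ∧ t ∈ Ioo 0 T)}
  have hN₁ : volume N₁ = 0 := by
    refine measure_mono_null ?_ (ae_iff.1 hode₁)
    exact fun u hu h => hu.2 (h hu.1)
  have hN₂ : volume N₂ = 0 := by
    have hends : volume ({0, T} : Set ℝ) = 0 := (toFinite _).measure_zero _
    refine measure_mono_null ?_ (measure_union_null (ae_iff.1 hode₂) hends)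
    rintro t ⟨ht, hnot⟩
    by_cases hd : HasDerivAt γ₂ (b (γ₂ t)) t
    · right
      by_contra hne
      simp only [mem_insert_iff, mem_singleton_iff, not_or] at hne
      exact hnot ⟨hd, lt_of_le_of_ne ht.1 (Ne.symm hne.1), lt_of_le_of_ne ht.2 hne.2⟩
    · exact Or.inl fun h => hd (h ht)
  -- parameters of `γ₁` at which `γ₂` passes at an exceptional time
  set B : Set ℝ := {u ∈ Icc 0 (T / 2) | HasDerivAt γ₁ (b (γ₁ u)) u ∧ b (γ₁ u) ≠ 0 ∧
    γ₁ u ∈ γ₂ '' N₂}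
  have hB : volume B = 0 :=
    volume_eq_zero_of_image_subset_image h₂ (fun t ht => ht.1) hN₂
      (fun u hu => ⟨_, hu.2.2.1, hu.2.1⟩) (image_subset_iff.2 fun u hu => hu.2.2.2)
  set M : Set ℝ := {t ∈ Icc 0 T | HasDerivAt γ₂ (b (γ₂ t)) t ∧ b (γ₂ t) ≠ 0 ∧
    γ₂ t ∈ γ₁ '' (N₁ ∪ B)}
  have hM : volume M = 0 :=
    volume_eq_zero_of_image_subset_image h₁ (union_subset (fun t ht => ht.1) fun t ht => ht.1)
      (measure_union_null hN₁ hB)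
      (fun u hu => ⟨_, hu.2.2.1, hu.2.1⟩) (image_subset_iff.2 fun u hu => hu.2.2.2)
  set Z : Set ℝ := {t ∈ Icc 0 T | b (γ₂ t) = 0} with hZdef
  have hZ : MeasurableSet Z := by
    have hc : Continuous (IccExtend hT.le ((Icc 0 T).domRestrict γ₂)) :=
      h₂.continuousOn.domRestrict.Icc_extend'
    have hm : MeasurableSet {t | b (IccExtend hT.le ((Icc 0 T).domRestrict γ₂) t) = 0} :=
      (hb.comp hc.measurable) (measurableSet_singleton 0)
    convert measurableSet_Icc.inter hm using 1
    ext t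
    simp only [hZdef, mem_ofPred_eq, mem_inter_iff]
    refine and_congr_right fun ht => ?_
    rw [IccExtend_of_mem _ _ ht, domRestrict_apply]
  set D : Set ℝ := (Icc 0 T \ Z) \ toMeasurable volume (N₂ ∪ M)
  have hDmeas : MeasurableSet D := (measurableSet_Icc.diff hZ).diff (measurableSet_toMeasurable _ _)
  have hDprop : ∀ t ∈ D, t ∈ Icc 0 T ∧ ∀ s ∈ Icc 0 T, φ s = φ t → HasDerivAt φ 1 s := by
    rintro t ⟨⟨ht, htZ⟩, htNM⟩
    have htNM' : t ∉ N₂ ∪ M := fun h => htNM (subset_toMeasurable _ _ h)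
    have hbt : b (γ₂ t) ≠ 0 := fun h => htZ ⟨ht, h⟩
    have hdt : HasDerivAt γ₂ (b (γ₂ t)) t := by
      by_contra h
      exact htNM' (Or.inl ⟨ht, fun h' => h h'.1⟩)
    have hnot : φ t ∉ N₁ ∪ B := fun h =>
      htNM' (Or.inr ⟨ht, hdt, hbt, φ t, h, hφ t ht⟩)
    have hd1 : HasDerivAt γ₁ (b (γ₁ (φ t))) (φ t) := by
      by_contra h
      exact hnot (Or.inl ⟨hφmem t ht, h⟩)
    have hb1 : b (γ₁ (φ t)) ≠ 0 := by rwa [hφ t ht]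
    refine ⟨ht, fun s hs hst => ?_⟩
    have hgood : HasDerivAt γ₂ (b (γ₂ s)) s ∧ s ∈ Ioo 0 T := by
      by_contra h
      refine hnot (Or.inr ⟨hφmem t ht, hd1, hb1, s, ⟨hs, h⟩, ?_⟩)
      rw [← hφ s hs, hst]
    have hnhds : Icc 0 T ∈ 𝓝 s := Icc_mem_nhds hgood.2.1 hgood.2.2
    rw [← hst] at hd1 hb1
    refine hasDerivAt_one_of_comp_eq (g := γ₂) hb1 hd1 ?_ (hφc.continuousAt hnhds) ?_
    · rw [hφ s hs]
      exact hgood.1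
    · filter_upwards [hnhds] with r hr using hφ r hr
  have hDinj : InjOn φ D := by
    have key : ∀ s ∈ D, ∀ t ∈ D, s ≤ t → φ s = φ t → s = t := by
      intro s hs t ht hst h
      have hsub : Icc s t ⊆ Icc 0 T := Icc_subset_Icc (hDprop s hs).1.1 (hDprop t ht).1.2
      exact eq_of_forall_hasDerivAt_pos hst (hφc.mono hsub) h rfl fun r hr hrt =>
        ⟨1, one_pos, (hDprop t ht).2 r (hsub hr) hrt⟩
    intro s hs t ht h
    rcases le_total s t with hst | hst
    · exact key s hs t ht hst h
    · exact (key t ht s hs hst h.symm).symm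
  have hDvol : volume D ≤ ENNReal.ofReal (T / 2) := by
    have harea := lintegral_image_eq_lintegral_abs_deriv_mul hDmeas
      (fun t ht => ((hDprop t ht).2 t (hDprop t ht).1 rfl).hasDerivWithinAt) hDinj (fun _ => 1)
    simp only [abs_one, ENNReal.ofReal_one, one_mul, setLIntegral_one] at harea
    rw [← harea]
    have hsub : φ '' D ⊆ Icc 0 (T / 2) :=
      image_subset_iff.2 fun t ht => hφmem t (hDprop t ht).1
    simpa using measure_mono (μ := volume) hsub
  have hIcc : ENNReal.ofReal (T / 2) + ENNReal.ofReal (T / 2)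
      ≤ volume Z + ENNReal.ofReal (T / 2) := by
    rw [← ENNReal.ofReal_add (by positivity) (by positivity), add_halves]
    calc ENNReal.ofReal T = volume (Icc 0 T) := by rw [Real.volume_Icc, sub_zero]
      _ ≤ volume (Z ∪ D ∪ toMeasurable volume (N₂ ∪ M)) := measure_mono fun t ht => by
          by_cases h1 : t ∈ Z
          · exact Or.inl (Or.inl h1)
          · by_cases h2 : t ∈ toMeasurable volume (N₂ ∪ M)
            · exact Or.inr h2
            · exact Or.inl (Or.inr ⟨⟨ht, h1⟩, h2⟩)
      _ ≤ volume Z + volume D + volume (toMeasurable volume (N₂ ∪ M)) :=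
          (measure_union_le _ _).trans (add_le_add_left (measure_union_le _ _) _)
      _ = volume Z + volume D := by
          rw [measure_toMeasurable, measure_union_null hN₂ hM, add_zero]
      _ ≤ volume Z + ENNReal.ofReal (T / 2) := by gcongr
  have hZle : ENNReal.ofReal (T / 2) ≤ volume Z :=
    (ENNReal.add_le_add_iff_right ENNReal.ofReal_ne_top).1 hIcc
  calc ENNReal.ofReal (T / 2) ≤ volume Z := hZle
    _ ≤ volume ({t ∈ Icc 0 T | HasDerivAt γ₂ 0 t} ∪ N₂) := measure_mono fun t ht => by
        by_cases h : t ∈ N₂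
        · exact Or.inr h
        · refine Or.inl ⟨ht.1, ?_⟩
          rw [← ht.2]
          by_contra h'
          exact h ⟨ht.1, fun h'' => h' h''.1⟩
    _ ≤ volume {t ∈ Icc 0 T | HasDerivAt γ₂ 0 t} + volume N₂ := measure_union_le _ _
    _ = volume {t ∈ Icc 0 T | HasDerivAt γ₂ 0 t} := by rw [hN₂, add_zero]
end

section
/- Let K ⊆ ℝ^d be compact and let C be a connected component of K. Then there exists a sequence (φₙ) of smooth compactly supported functions on ℝ^d such that: (1) 0 ≤ φₙ ≤ 1 everywhere and φₙ takes only values 0 and 1 on K; (2) φₙ = 1 on C for every n; (3) φₙ(x) → 0 as n → ∞ for every x ∈ K \ C; (4) the support of ∇φₙ is disjoint from K for every n. -/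
open MeasureTheory Set Metric Filter

open scoped Topology Manifold ContDiff

/-- In a compact Hausdorff second-countable space, a connected component is the intersection of
a decreasing sequence of clopen sets. -/
theorem exists_antitone_isClopen_iInter_eq_connectedComponent {X : Type*} [TopologicalSpace X]
    [CompactSpace X] [T2Space X] [SecondCountableTopology X] (x : X) :
    ∃ V : ℕ → Set X, Antitone V ∧ (∀ n, IsClopen (V n)) ∧ ⋂ n, V n = connectedComponent x := by
  obtain ⟨T, hT, hTU⟩ := TopologicalSpace.isOpen_iUnion_countable
    (fun s : {s : Set X // IsClopen s ∧ x ∈ s} => (s : Set X)ᶜ)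
    (fun s => s.2.1.compl.isOpen)
  obtain ⟨f, hf⟩ := (hT.insert ⟨univ, isClopen_univ, mem_univ x⟩).exists_eq_range
    (insert_nonempty _ _)
  refine ⟨fun n => ⋂ i ∈ Iic n, (f i : Set X), fun m n hmn =>
    biInter_subset_biInter_left (Iic_subset_Iic.2 hmn),
    fun n => (finite_Iic n).isClopen_biInter fun i _ => (f i).2.1, ?_⟩
  refine Subset.antisymm (fun y hy => ?_) (subset_iInter fun n => subset_iInter₂ fun i _ =>
    (f i).2.1.connectedComponent_subset (f i).2.2)
  rw [connectedComponent_eq_iInter_isClopen]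
  by_contra hy'
  have hyU : y ∈ ⋃ s : {s : Set X // IsClopen s ∧ x ∈ s}, (s : Set X)ᶜ := by
    rwa [← compl_iInter]
  rw [← hTU] at hyU
  obtain ⟨s, hs, hys⟩ := mem_iUnion₂.1 hyU
  obtain ⟨i, rfl⟩ : s ∈ range f := hf ▸ mem_insert_of_mem _ hs
  exact hys (mem_iInter₂.1 (mem_iInter.1 hy i) i (mem_Iic.2 le_rfl))

/-- Two disjoint compact sets are separated by a smooth compactly supported function which is
constant near each of them. -/
theorem exists_contDiff_hasCompactSupport_zero_one_nhds {E : Type*} [NormedAddCommGroup E]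
    [NormedSpace ℝ E] [FiniteDimensional ℝ E] {A B : Set E} (hA : IsCompact A) (hB : IsCompact B)
    (hAB : Disjoint A B) :
    ∃ f : E → ℝ, ContDiff ℝ ∞ f ∧ HasCompactSupport f ∧ (∀ x, f x ∈ Icc (0 : ℝ) 1) ∧
      (∀ᶠ x in 𝓝ˢ A, f x = 1) ∧ ∀ᶠ x in 𝓝ˢ B, f x = 0 := by
  obtain ⟨r, hr⟩ := hA.isBounded.subset_ball (0 : E)
  have hd : Disjoint (B ∪ (ball 0 r)ᶜ) A :=
    disjoint_union_left.2 ⟨hAB.symm, disjoint_compl_left_iff_subset.2 hr⟩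
  have : ProperSpace E := FiniteDimensional.proper ℝ E
  obtain ⟨f, h0, h1, hf⟩ := exists_contMDiffMap_zero_one_nhds_of_isClosed 𝓘(ℝ, E) (n := ⊤)
    (hB.isClosed.union isOpen_ball.isClosed_compl) hA.isClosed hd
  refine ⟨f, f.contMDiff.contDiff, ?_, hf, h1,
    h0.filter_mono (nhdsSet_mono subset_union_left)⟩
  refine HasCompactSupport.intro (isCompact_closedBall (0 : E) r) fun x hx => ?_
  exact h0.self_of_nhdsSet x (Or.inr fun hx' => hx (ball_subset_closedBall hx'))

theorem notMem_tsupport_fderiv_of_eventuallyEq_const {E F : Type*} [NormedAddCommGroup E]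
    [NormedSpace ℝ E] [NormedAddCommGroup F] [NormedSpace ℝ F] {f : E → F} {x : E} {c : F}
    (h : f =ᶠ[𝓝 x] fun _ => c) : x ∉ tsupport (fderiv ℝ f) := by
  rw [notMem_tsupport_iff_eventuallyEq]
  filter_upwards [h.fderiv (𝕜 := ℝ)] with y hy
  simpa using hy

/-- For a compact `K ⊆ ℝ^d` and a connected component `C` of `K`
(the component of a point `x₀ ∈ K`), there is a sequence `φₙ` of smooth compactly
supported functions with values in `[0,1]`, `{0,1}`-valued on `K`, equal to `1` on `C`,
tending pointwise to `0` on `K \ C`, and whose gradients have support disjoint from `K`. -/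
theorem stmt3 (d : ℕ) (K : Set (EuclideanSpace ℝ (Fin d))) (hK : IsCompact K)
    (x₀ : EuclideanSpace ℝ (Fin d)) (hx₀ : x₀ ∈ K) :
    ∃ φ : ℕ → EuclideanSpace ℝ (Fin d) → ℝ,
      (∀ n, ContDiff ℝ (⊤ : ℕ∞) (φ n)) ∧ (∀ n, HasCompactSupport (φ n)) ∧
      (∀ n x, φ n x ∈ Set.Icc (0:ℝ) 1) ∧
      (∀ n, ∀ x ∈ K, φ n x = 0 ∨ φ n x = 1) ∧
      (∀ n, ∀ x ∈ connectedComponentIn K x₀, φ n x = 1) ∧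
      (∀ x ∈ K \ connectedComponentIn K x₀,
        Filter.Tendsto (fun n => φ n x) Filter.atTop (nhds 0)) ∧
      (∀ n, Disjoint (tsupport (fun x => fderiv ℝ (φ n) x)) K) := by
  have : CompactSpace K := isCompact_iff_compactSpace.1 hK
  obtain ⟨V, hVanti, hVclopen, hV⟩ :=
    exists_antitone_isClopen_iInter_eq_connectedComponent (⟨x₀, hx₀⟩ : K)
  have hcompact {S : Set K} (hS : IsClosed S) : IsCompact (Subtype.val '' S) :=
    hS.isCompact.image continuous_subtype_val
  choose φ hsmooth hsupp hIcc hone hzero using fun n =>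
    exists_contDiff_hasCompactSupport_zero_one_nhds (hcompact (hVclopen n).isClosed)
      (hcompact (hVclopen n).compl.isClosed)
      ((disjoint_image_iff Subtype.val_injective).2 disjoint_compl_right)
  have hnhds (n : ℕ) (x : K) : (x ∈ V n ∧ φ n =ᶠ[𝓝 (x : EuclideanSpace ℝ (Fin d))] fun _ => 1) ∨
      (x ∉ V n ∧ φ n =ᶠ[𝓝 (x : EuclideanSpace ℝ (Fin d))] fun _ => 0) := by
    by_cases hx : x ∈ V n
    · exact Or.inl ⟨hx, (hone n).filter_mono (nhds_le_nhdsSet (mem_image_of_mem _ hx))⟩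
    · exact Or.inr ⟨hx, (hzero n).filter_mono (nhds_le_nhdsSet (mem_image_of_mem _ hx))⟩
  rw [connectedComponentIn_eq_image hx₀, ← hV]
  refine ⟨φ, hsmooth, hsupp, hIcc, fun n x hx => ?_, ?_, ?_, fun n => ?_⟩
  · exact (hnhds n ⟨x, hx⟩).elim (fun h => Or.inr h.2.eq_of_nhds) fun h => Or.inl h.2.eq_of_nhds
  · rintro n _ ⟨x, hx, rfl⟩
    exact (hone n).self_of_nhdsSet _ (mem_image_of_mem _ (mem_iInter.1 hx n))
  · rintro x ⟨hxK, hx⟩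
    obtain ⟨N, hN⟩ : ∃ N, (⟨x, hxK⟩ : K) ∉ V N := by
      by_contra! h
      exact hx ⟨⟨x, hxK⟩, mem_iInter.2 h, rfl⟩
    refine tendsto_const_nhds.congr' ?_
    filter_upwards [eventually_ge_atTop N] with n hn
    exact ((hzero n).self_of_nhdsSet _
      (mem_image_of_mem Subtype.val fun h => hN (hVanti hn h))).symm
  · refine disjoint_right.2 fun x hx => ?_
    exact (hnhds n ⟨x, hx⟩).elim (fun h => notMem_tsupport_fderiv_of_eventuallyEq_const h.2)
      fun h => notMem_tsupport_fderiv_of_eventuallyEq_const h.2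
end

section
/- Let b : ℝ² → ℝ² be bounded Borel, u ∈ L^∞(ℝ²), and suppose div(u b) = λ in the sense of distributions, where λ is a Radon measure. Let M be the set of points x where b(x) = 0, b is approximately differentiable at x, and the approximate differential of b at x vanishes. Then |λ|(M) = 0, i.e. the restriction of λ to M is the zero measure. -/
open MeasureTheory Set Metric Filter Asymptotics

local notation "E2" => EuclideanSpace ℝ (Fin 2)

/-- Smooth cutoff functions between concentric balls of radii `r` and `2 r`, with gradient bounded
by a universal constant over `r`. -/
lemma exists_smooth_cutoff (E : Type*) [NormedAddCommGroup E] [NormedSpace ℝ E]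
    [FiniteDimensional ℝ E] :
    ∃ C : ℝ, 0 ≤ C ∧ ∀ (x : E) (r : ℝ), 0 < r → ∃ φ : E → ℝ,
      ContDiff ℝ (⊤ : ℕ∞) φ ∧ HasCompactSupport φ ∧ (∀ y, 0 ≤ φ y) ∧ (∀ y, φ y ≤ 1) ∧
      (∀ y ∈ closedBall x r, φ y = 1) ∧ (∀ y, y ∉ closedBall x (2 * r) → φ y = 0) ∧
      (∀ y, ‖fderiv ℝ φ y‖ ≤ C / r) ∧ (∀ y, y ∉ ball x (2 * r) → fderiv ℝ φ y = 0) := by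
  let χ : ContDiffBump (0 : E) := ⟨1, 3 / 2, one_pos, by norm_num⟩
  have hχ : ContDiff ℝ (⊤ : ℕ∞) χ := χ.contDiff
  obtain ⟨C, hC⟩ := (χ.hasCompactSupport.fderiv (𝕜 := ℝ)).exists_bound_of_continuous
    (hχ.continuous_fderiv (by simp))
  refine ⟨C, (norm_nonneg _).trans (hC 0), fun x r hr => ?_⟩
  have hd : ∀ y, HasFDerivAt (fun y => χ (r⁻¹ • (y - x))) (r⁻¹ • fderiv ℝ χ (r⁻¹ • (y - x))) y := by
    intro y
    have h1 : HasFDerivAt (fun y : E => r⁻¹ • (y - x)) (r⁻¹ • ContinuousLinearMap.id ℝ E) y :=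
      ((hasFDerivAt_id y).sub_const x).const_smul r⁻¹
    have h2 := ((hχ.differentiable (by simp)) (r⁻¹ • (y - x))).hasFDerivAt.comp y h1
    have e : (fderiv ℝ χ (r⁻¹ • (y - x))).comp (r⁻¹ • ContinuousLinearMap.id ℝ E) =
        r⁻¹ • fderiv ℝ χ (r⁻¹ • (y - x)) := by
      ext v
      simp
    exact e ▸ h2
  have hn : ∀ y, ‖r⁻¹ • (y - x)‖ = dist y x / r := by
    intro y
    rw [norm_smul, norm_inv, Real.norm_of_nonneg hr.le, dist_eq_norm, div_eq_inv_mul]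
  have h0 : ∀ y, 2 * r ≤ dist y x → χ (r⁻¹ • (y - x)) = 0 := by
    intro y hy
    apply χ.zero_of_le_dist
    rw [dist_zero_right, hn, le_div_iff₀ hr]
    change 3 / 2 * r ≤ _
    linarith
  refine ⟨fun y => χ (r⁻¹ • (y - x)), hχ.comp (by fun_prop), ?_, fun y => χ.nonneg,
    fun y => χ.le_one, ?_, ?_, ?_, ?_⟩
  · apply HasCompactSupport.intro (isCompact_closedBall x (2 * r))
    intro y hy
    exact h0 y (by simpa using (not_le.1 hy).le)
  · intro y hy
    apply χ.one_of_mem_closedBall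
    rw [mem_closedBall, dist_zero_right, hn]
    exact (div_le_one hr).2 hy
  · intro y hy
    exact h0 y (by simpa using (not_le.1 hy).le)
  · intro y
    rw [(hd y).fderiv, norm_smul, norm_inv, Real.norm_of_nonneg hr.le, div_eq_inv_mul]
    exact mul_le_mul_of_nonneg_left (hC _) (by positivity)
  · intro y hy
    rw [(hd y).fderiv]
    have : fderiv ℝ χ (r⁻¹ • (y - x)) = 0 := by
      apply image_eq_zero_of_notMem_tsupport
      intro hmem
      have := tsupport_fderiv_subset ℝ hmem
      rw [χ.tsupport_eq, mem_closedBall, dist_zero_right, hn, div_le_iff₀ hr] at this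
      change _ ≤ 3 / 2 * r at this
      rw [mem_ball, not_lt] at hy
      linarith
    rw [this, smul_zero]

/-- A function bounded below by a positive constant near `0` cannot decay geometrically along
dyadic scales. -/
lemma false_of_dyadic_decay {m : ℝ → ℝ} {a r₀ : ℝ} (ha : 0 < a) (hr₀ : 0 < r₀)
    (hlow : ∀ r, 0 < r → r < r₀ → a * r ^ 2 ≤ m r)
    (hup : ∀ r, 0 < r → r < r₀ → m r ≤ a / 4 * r ^ 2 + m (2 * r) / 8) : False := by
  have key : ∀ k : ℕ, ∀ r, 0 < r → 2 ^ k * r < r₀ →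
      (a / 2) * 2 ^ k * (2 ^ k * r) ^ 2 ≤ m (2 ^ k * r) - a / 2 * (2 ^ k * r) ^ 2 := by
    intro k
    induction k with
    | zero =>
      intro r h1 h2
      have := hlow r h1 (by simpa using h2)
      simp only [pow_zero, one_mul, mul_one]
      linarith
    | succ k ih =>
      intro r h1 h2
      have hp : (0 : ℝ) < 2 ^ k * r := by positivity
      have e : (2 : ℝ) ^ (k + 1) * r = 2 * (2 ^ k * r) := by ring
      have hlt : 2 ^ k * r < r₀ := by rw [e] at h2; linarith
      have h3 := ih r h1 hlt
      have h4 := hup _ hp hlt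
      rw [e, pow_succ]
      nlinarith
  obtain ⟨k, hk⟩ := pow_unbounded_of_one_lt (m (r₀ / 2) / (a / 2 * (r₀ / 2) ^ 2)) one_lt_two
  have h2k : (0 : ℝ) < 2 ^ k := by positivity
  have e : (2 : ℝ) ^ k * (r₀ / 2 / 2 ^ k) = r₀ / 2 := by field_simp
  have h := key k (r₀ / 2 / 2 ^ k) (by positivity) (by rw [e]; linarith)
  rw [e] at h
  rw [div_lt_iff₀ (by positivity)] at hk
  have : 0 < a / 2 * (r₀ / 2) ^ 2 := by positivity
  linarith

/-- The pairing of a bounded multiple of a field `b` with a cutoff at scale `r` is controlled by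
the mean of `‖b‖` on the ball where the gradient of the cutoff lives. -/
lemma abs_integral_mul_fderiv_le {E : Type*} [NormedAddCommGroup E] [NormedSpace ℝ E]
    [MeasurableSpace E] [BorelSpace E] [FiniteDimensional ℝ E] {μ : Measure E}
    [IsLocallyFiniteMeasure μ] {b : E → E} (hb : Measurable b) {Cb : ℝ} (hbb : ∀ x, ‖b x‖ ≤ Cb)
    {u φ : E → ℝ} {Cu K : ℝ} (hub : ∀ x, |u x| ≤ Cu) {x : E} {R : ℝ}
    (hK : ∀ y, ‖fderiv ℝ φ y‖ ≤ K) (hsupp : ∀ y, y ∉ ball x R → fderiv ℝ φ y = 0) :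
    |∫ y, u y * fderiv ℝ φ y (b y) ∂μ| ≤
      Cu * K * (μ.real (ball x R) * ⨍ y in ball x R, ‖b y‖ ∂μ) := by
  have hCu : 0 ≤ Cu := (abs_nonneg _).trans (hub x)
  have hfin : μ (ball x R) ≠ ⊤ := measure_ball_lt_top.ne
  have hint : IntegrableOn (fun y => ‖b y‖) (ball x R) μ := by
    refine Measure.integrableOn_of_bounded (M := Cb) hfin hb.norm.aestronglyMeasurable ?_
    exact Eventually.of_forall fun y => by simpa using hbb y
  have hav : μ.real (ball x R) * ⨍ y in ball x R, ‖b y‖ ∂μ = ∫ y in ball x R, ‖b y‖ ∂μ := by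
    simpa using measure_smul_setAverage (μ := μ) (fun y => ‖b y‖) hfin
  rw [hav, ← setIntegral_eq_integral_of_forall_compl_eq_zero (s := ball x R)
    (fun y hy => by simp [hsupp y hy]), ← integral_const_mul, ← Real.norm_eq_abs]
  refine norm_integral_le_of_norm_le (hint.const_mul _) (Eventually.of_forall fun y => ?_)
  rw [norm_mul, Real.norm_eq_abs, mul_assoc]
  refine mul_le_mul (hub y) ?_ (norm_nonneg _) hCu
  exact ((fderiv ℝ φ y).le_opNorm _).trans (mul_le_mul_of_nonneg_right (hK y) (norm_nonneg _))

/-- Replacing a density by its value at the centre costs at most its mean oscillation. -/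
lemma abs_mul_measureReal_closedBall_le {E : Type*} [MetricSpace E] [ProperSpace E]
    [MeasurableSpace E] [BorelSpace E] {ν : Measure E} [IsLocallyFiniteMeasure ν] {σ φ : E → ℝ}
    (hσ : LocallyIntegrable σ ν) (hφ : Continuous φ) (h0 : ∀ y, 0 ≤ φ y) (h1 : ∀ y, φ y ≤ 1)
    {x : E} {r R : ℝ} (hone : ∀ y ∈ closedBall x r, φ y = 1)
    (hsupp : ∀ y, y ∉ closedBall x R → φ y = 0) :
    |σ x| * ν.real (closedBall x r) ≤ |∫ y, σ y * φ y ∂ν| +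
      ν.real (closedBall x R) * ⨍ y in closedBall x R, ‖σ y - σ x‖ ∂ν := by
  have hfin : ∀ s, ν (closedBall x s) ≠ ⊤ := fun s => measure_closedBall_lt_top.ne
  have hσR : IntegrableOn σ (closedBall x R) ν := hσ.integrableOn_isCompact (isCompact_closedBall x R)
  have hcs : HasCompactSupport φ := HasCompactSupport.intro (isCompact_closedBall x R) hsupp
  have hφi : Integrable φ ν := hφ.integrable_of_hasCompactSupport hcs
  have hosc : IntegrableOn (fun y => ‖σ y - σ x‖) (closedBall x R) ν :=
    (hσR.sub (integrableOn_const (hfin R))).norm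
  have hσφ : Integrable (fun y => σ y * φ y) ν := by
    simpa [mul_comm] using hσ.integrable_smul_left_of_hasCompactSupport hφ hcs
  have hav : ν.real (closedBall x R) * ⨍ y in closedBall x R, ‖σ y - σ x‖ ∂ν =
      ∫ y in closedBall x R, ‖σ y - σ x‖ ∂ν := by
    simpa using measure_smul_setAverage (μ := ν) (fun y => ‖σ y - σ x‖) (hfin R)
  have hmass : ν.real (closedBall x r) ≤ ∫ y, φ y ∂ν := by
    have : ∫ y in closedBall x r, φ y ∂ν = ν.real (closedBall x r) := by
      rw [setIntegral_congr_fun measurableSet_closedBall hone]; simp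
    rw [← this]
    exact setIntegral_le_integral hφi (Eventually.of_forall h0)
  have hdiff : |σ x * (∫ y, φ y ∂ν) - ∫ y, σ y * φ y ∂ν| ≤
      ∫ y in closedBall x R, ‖σ y - σ x‖ ∂ν := by
    rw [← integral_const_mul, ← integral_sub (hφi.const_mul _) hσφ,
      ← setIntegral_eq_integral_of_forall_compl_eq_zero (s := closedBall x R)
        (fun y hy => by simp [hsupp y hy]), ← Real.norm_eq_abs]
    refine norm_integral_le_of_norm_le hosc (Eventually.of_forall fun y => ?_)
    rw [← sub_mul, norm_mul, norm_sub_rev, Real.norm_of_nonneg (h0 y)]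
    exact mul_le_of_le_one_right (norm_nonneg _) (h1 y)
  rw [hav]
  have h2 : |σ x| * (∫ y, φ y ∂ν) = |σ x * ∫ y, φ y ∂ν| := by
    rw [abs_mul, abs_of_nonneg (integral_nonneg h0)]
  have h3 := mul_le_mul_of_nonneg_left hmass (abs_nonneg (σ x))
  have h4 := abs_sub_abs_le_abs_sub (σ x * ∫ y, φ y ∂ν) (∫ y, σ y * φ y ∂ν)
  linarith

/-- At a point where the volume density with respect to `ν` is finite, `ν` charges small discs at
least proportionally to their area. -/
lemma exists_mul_sq_le_measureReal_closedBall {ν : Measure E2} [IsLocallyFiniteMeasure ν] {x : E2}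
    {D : ENNReal} (hD : D ≠ ⊤)
    (h : Tendsto (fun r => volume (closedBall x r) / ν (closedBall x r))
      (nhdsWithin 0 (Ioi 0)) (nhds D)) :
    ∃ a : ℝ, 0 < a ∧ ∀ᶠ r in nhdsWithin (0 : ℝ) (Ioi 0), a * r ^ 2 ≤ ν.real (closedBall x r) := by
  have hV : 0 < volume.real (closedBall (0 : E2) 1) :=
    ENNReal.toReal_pos (measure_closedBall_pos volume _ one_pos).ne' measure_closedBall_lt_top.ne
  have hL : 0 < D.toReal + 1 := by positivity
  refine ⟨volume.real (closedBall (0 : E2) 1) / (D.toReal + 1), by positivity, ?_⟩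
  have hlt : D < ENNReal.ofReal (D.toReal + 1) := by
    rw [ENNReal.lt_ofReal_iff_toReal_lt hD]; linarith
  filter_upwards [h.eventually (gt_mem_nhds hlt), self_mem_nhdsWithin] with r hr hr0
  have hr0 : 0 < r := hr0
  have hν0 : ν (closedBall x r) ≠ 0 := by
    intro h0
    rw [h0, ENNReal.div_zero (measure_closedBall_pos volume _ hr0).ne'] at hr
    exact not_top_lt hr
  have hle := (ENNReal.div_le_iff hν0 measure_closedBall_lt_top.ne).1 hr.le
  have := ENNReal.toReal_mono (ENNReal.mul_ne_top ENNReal.ofReal_ne_top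
    measure_closedBall_lt_top.ne) hle
  rw [ENNReal.toReal_mul, ENNReal.toReal_ofReal hL.le, ← measureReal_def, ← measureReal_def,
    measureReal_def, Measure.addHaar_closedBall' _ _ hr0.le, ENNReal.toReal_mul,
    ENNReal.toReal_ofReal (by positivity)] at this
  rw [div_mul_eq_mul_div, div_le_iff₀ hL]
  simp only [finrank_euclideanSpace, Fintype.card_fin] at this
  rw [← measureReal_def] at this
  linarith

/-- A density `σ` of a divergence `div (u b)` with respect to `ν` vanishes at every Lebesgue point
where `b` has vanishing mean slope and `ν` charges discs at least proportionally to their area. -/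
lemma density_eq_zero_of_isLittleO {b : E2 → E2} (hb : Measurable b) {Cb : ℝ}
    (hbb : ∀ x, ‖b x‖ ≤ Cb) {u : E2 → ℝ} {Cu : ℝ} (hub : ∀ x, |u x| ≤ Cu)
    {ν : Measure E2} [IsLocallyFiniteMeasure ν] {σ : E2 → ℝ} (hσ : LocallyIntegrable σ ν)
    (heq : ∀ φ : E2 → ℝ, ContDiff ℝ (⊤ : ℕ∞) φ → HasCompactSupport φ →
      (∫ x, u x * fderiv ℝ φ x (b x)) + ∫ x, σ x * φ x ∂ν = 0) {x : E2}
    (hosc : Tendsto (fun r => ⨍ y in closedBall x r, ‖σ y - σ x‖ ∂ν)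
      (nhdsWithin 0 (Ioi 0)) (nhds 0))
    (hbx : (fun r => ⨍ y in ball x r, ‖b y‖) =o[nhdsWithin 0 (Ioi 0)] (fun r : ℝ => r))
    {a : ℝ} (ha : 0 < a)
    (hlow : ∀ᶠ r in nhdsWithin (0 : ℝ) (Ioi 0), a * r ^ 2 ≤ ν.real (closedBall x r)) :
    σ x = 0 := by
  by_contra hne
  have hs : 0 < |σ x| := abs_pos.2 hne
  obtain ⟨C, hC, hcut⟩ := exists_smooth_cutoff E2
  have hCu : 0 ≤ Cu := (abs_nonneg _).trans (hub x)
  set V := volume.real (ball (0 : E2) 1) with hVdef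
  have hV : 0 ≤ V := measureReal_nonneg
  have hball : ∀ r, 0 < r → volume.real (ball x (2 * r)) = 4 * r ^ 2 * V := by
    intro r hr
    rw [measureReal_def, Measure.addHaar_ball _ _ (by positivity), ENNReal.toReal_mul,
      ENNReal.toReal_ofReal (by positivity), ← measureReal_def]
    simp only [finrank_euclideanSpace, Fintype.card_fin]
    ring
  set δ := |σ x| * (a / 4) / (8 * (Cu * C * V) + 1) with hδdef
  have hδ : 0 < δ := by positivity
  have hδle : 8 * (Cu * C * V) * δ ≤ |σ x| * (a / 4) := by
    have : (8 * (Cu * C * V) + 1) * δ = |σ x| * (a / 4) := by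
      rw [hδdef]; field_simp
    linarith
  have htwo : Tendsto (fun r : ℝ => 2 * r) (nhdsWithin 0 (Ioi 0)) (nhdsWithin 0 (Ioi 0)) := by
    refine tendsto_nhdsWithin_iff.2 ⟨?_, ?_⟩
    · have : Tendsto (fun r : ℝ => 2 * r) (nhds 0) (nhds (2 * 0)) :=
        (continuous_const.mul continuous_id).tendsto 0
      rw [mul_zero] at this
      exact this.mono_left nhdsWithin_le_nhds
    · filter_upwards [self_mem_nhdsWithin] with r hr
      exact mul_pos (two_pos : (0 : ℝ) < 2) hr
  have e1 := htwo.eventually (hbx.bound hδ)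
  have e2 := htwo.eventually (hosc.eventually (gt_mem_nhds (show 0 < |σ x| / 8 by positivity)))
  have hev : ∀ᶠ r in nhdsWithin (0 : ℝ) (Ioi 0), a * r ^ 2 ≤ ν.real (closedBall x r) ∧
      ν.real (closedBall x r) ≤ a / 4 * r ^ 2 + ν.real (closedBall x (2 * r)) / 8 := by
    filter_upwards [hlow, e1, e2, self_mem_nhdsWithin] with r h1 h2 h3 hr
    refine ⟨h1, ?_⟩
    have hr : 0 < r := hr
    obtain ⟨φ, hφ, hφc, h0, hφ1, hone, hsupp, hK, hK0⟩ := hcut x r hr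
    have A := abs_integral_mul_fderiv_le (μ := volume) hb hbb hub hK hK0
    have B := abs_mul_measureReal_closedBall_le hσ hφ.continuous h0 hφ1 hone hsupp
    have hE : |∫ y, σ y * φ y ∂ν| = |∫ y, u y * fderiv ℝ φ y (b y)| := by
      rw [eq_neg_of_add_eq_zero_left (heq φ hφ hφc), abs_neg]
    rw [hE] at B
    rw [hball r hr] at A
    have h2' : ⨍ y in ball x (2 * r), ‖b y‖ ≤ δ * (2 * r) := by
      have := (le_abs_self _).trans h2
      rwa [Real.norm_of_nonneg (by positivity)] at this
    have A2 : Cu * (C / r) * (4 * r ^ 2 * V * ⨍ y in ball x (2 * r), ‖b y‖) ≤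
        |σ x| * (a / 4) * r ^ 2 := by
      calc _ ≤ Cu * (C / r) * (4 * r ^ 2 * V * (δ * (2 * r))) := by gcongr
        _ = (8 * (Cu * C * V) * δ) * r ^ 2 := by field_simp; ring
        _ ≤ _ := by gcongr
    have B2 := mul_le_mul_of_nonneg_left h3.le
      (measureReal_nonneg (μ := ν) (s := closedBall x (2 * r)))
    refine le_of_mul_le_mul_left ?_ hs
    linarith
  obtain ⟨r₀, hr₀, hr⟩ := mem_nhdsGT_iff_exists_Ioo_subset.1 hev
  exact false_of_dyadic_decay (m := fun r => ν.real (closedBall x r)) ha hr₀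
    (fun r h1 h2 => (hr ⟨h1, h2⟩).1) (fun r h1 h2 => (hr ⟨h1, h2⟩).2)

/-- locality of the divergence. If `u ∈ L^∞`, `b` is bounded Borel and
`div (u b) = λ` (a signed Radon measure `λ = μp − μm`) in the sense of distributions, then
`λ` restricted to the set `M` where `b` vanishes and is approximately differentiable with
vanishing approximate differential (i.e. `⨍_{B(x,r)} ‖b‖ = o(r)`) is the zero measure. -/
theorem stmt4 (b : E2 → E2) (hb : Measurable b) (Cb : ℝ) (hbb : ∀ x, ‖b x‖ ≤ Cb)
    (u : E2 → ℝ) (hu : Measurable u) (Cu : ℝ) (hub : ∀ x, |u x| ≤ Cu)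
    (μp μm : Measure E2) [IsLocallyFiniteMeasure μp] [IsLocallyFiniteMeasure μm]
    (heq : ∀ φ : E2 → ℝ, ContDiff ℝ (⊤ : ℕ∞) φ → HasCompactSupport φ →
      (∫ x, u x * fderiv ℝ φ x (b x)) + ((∫ x, φ x ∂μp) - (∫ x, φ x ∂μm)) = 0) :
    ∀ S : Set E2, MeasurableSet S →
      S ⊆ {x | b x = 0 ∧
        (fun r => ⨍ y in Metric.ball x r, ‖b y‖) =o[nhdsWithin 0 (Set.Ioi 0)]
          (fun r : ℝ => r)} →
      μp S = μm S := by
  intro S hS hSM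
  let ν := μp + μm
  have hloc : IsLocallyFiniteMeasure ν := ⟨fun x => by
    obtain ⟨s, hs, hs'⟩ := μp.finiteAt_nhds x
    obtain ⟨t, ht, ht'⟩ := μm.finiteAt_nhds x
    refine ⟨s ∩ t, inter_mem hs ht, ?_⟩
    exact ENNReal.add_lt_top.2
      ⟨(measure_mono inter_subset_left).trans_lt hs', (measure_mono inter_subset_right).trans_lt ht'⟩⟩
  have hp : μp ≪ ν := Measure.absolutelyContinuous_of_le (Measure.le_add_right le_rfl)
  have hm : μm ≪ ν := Measure.absolutelyContinuous_of_le (Measure.le_add_left le_rfl)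
  have hli : ∀ μ : Measure E2, IsLocallyFiniteMeasure μ →
      LocallyIntegrable (fun x => (μ.rnDeriv ν x).toReal) ν := by
    intro μ hμ x
    obtain ⟨s, hs, hs'⟩ := μ.finiteAt_nhds x
    exact ⟨s, hs, Measure.integrableOn_toReal_rnDeriv hs'.ne⟩
  have hlip := hli μp inferInstance
  have hlim := hli μm inferInstance
  have hdens : ∀ φ : E2 → ℝ, ContDiff ℝ (⊤ : ℕ∞) φ → HasCompactSupport φ →
      (∫ x, u x * fderiv ℝ φ x (b x)) +
        ∫ x, ((μp.rnDeriv ν x).toReal - (μm.rnDeriv ν x).toReal) * φ x ∂ν = 0 := by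
    intro φ hφ hφc
    rw [← heq φ hφ hφc, ← integral_rnDeriv_smul hp, ← integral_rnDeriv_smul hm]
    simp only [smul_eq_mul, sub_mul]
    rw [integral_sub]
    · simpa [mul_comm] using hlip.integrable_smul_left_of_hasCompactSupport hφ.continuous hφc
    · simpa [mul_comm] using hlim.integrable_smul_left_of_hasCompactSupport hφ.continuous hφc
  rw [← Measure.setLIntegral_rnDeriv hp, ← Measure.setLIntegral_rnDeriv hm]
  apply setLIntegral_congr_fun_ae hS
  filter_upwards [(Besicovitch.vitaliFamily ν).ae_tendsto_average_norm_sub (hlip.sub hlim),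
    Besicovitch.ae_tendsto_rnDeriv volume ν, Measure.rnDeriv_lt_top volume ν,
    Measure.rnDeriv_lt_top μp ν, Measure.rnDeriv_lt_top μm ν] with x hx hvol hD hfp hfm hxS
  obtain ⟨a, ha, hlow⟩ := exists_mul_sq_le_measureReal_closedBall hD.ne hvol
  have := density_eq_zero_of_isLittleO hb hbb hub (hlip.sub hlim) hdens
    (hx.comp (Besicovitch.tendsto_filterAt ν x)) (hSM hxS).2 ha hlow
  exact (ENNReal.toReal_eq_toReal_iff' hfp.ne hfm.ne).1 (sub_eq_zero.1 this)
end

section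
/- Let f : ℝ² → ℝ be Lipschitz with compact support and for r ∈ ℝ let E_r = f^{-1}(r). Then for L¹-a.e. r ∈ f(ℝ²): (1) H¹(E_r) < ∞; (2) the family of connected components of E_r having positive H¹-measure is countable; (3) H¹(E_r \ E_r^⋆) = 0, where E_r^⋆ is the union of the connected components of E_r with positive H¹-measure. -/
open MeasureTheory Set Metric Filter

local notation "E2" => EuclideanSpace ℝ (Fin 2)

/-- A continuous function on `[-1, 1]` with positive cosine stays in one interval of positivity. -/
lemma exists_int_abs_sub_lt_of_cos_pos {h : ℝ → ℝ} (hc : Continuous h)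
    (hpos : ∀ t ∈ Icc (-1 : ℝ) 1, 0 < Real.cos (h t)) :
    ∃ k : ℤ, ∀ t ∈ Icc (-1 : ℝ) 1, |h t - 2 * Real.pi * k| < Real.pi / 2 := by
  have hpi := Real.pi_pos
  set k := round (h (-1) / (2 * Real.pi)) with hk
  have hcos : ∀ t, Real.cos |h t - 2 * Real.pi * k| = Real.cos (h t) := fun t ↦ by
    rw [Real.cos_abs, mul_comm (2 * Real.pi), Real.cos_sub_int_mul_two_pi]
  refine ⟨k, fun t ht ↦ ?_⟩
  have h0 : |h (-1) - 2 * Real.pi * k| < Real.pi / 2 := by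
    by_contra! hcon
    have h1 : |h (-1) - 2 * Real.pi * k| ≤ Real.pi := by
      have := abs_sub_round (h (-1) / (2 * Real.pi))
      rw [← hk] at this
      have h2 : h (-1) - 2 * Real.pi * k = (2 * Real.pi) * (h (-1) / (2 * Real.pi) - k) := by
        field_simp
      rw [h2, abs_mul, abs_of_pos (by positivity)]
      nlinarith
    have := Real.cos_nonpos_of_pi_div_two_le_of_le hcon (by linarith)
    rw [hcos] at this
    exact absurd (hpos (-1) (by simp)) (not_lt.2 this)
  by_contra! hcon
  obtain ⟨s, hs, hs'⟩ := intermediate_value_Icc (f := fun t ↦ |h t - 2 * Real.pi * k|) ht.1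
    (by fun_prop) ⟨h0.le, hcon⟩
  have := hpos s ⟨hs.1, hs.2.trans ht.2⟩
  rw [← hcos, show |h s - 2 * Real.pi * k| = Real.pi / 2 from hs', Real.cos_pi_div_two] at this
  exact lt_irrefl _ this

/-- A continuous nowhere vanishing complex function on the plane has a continuous logarithm. -/
lemma exists_continuous_exp_eq {F : ℝ × ℝ → ℂ} (hF : Continuous F) (h0 : ∀ p, F p ≠ 0) :
    ∃ G : ℝ × ℝ → ℂ, Continuous G ∧ ∀ p, Complex.exp (G p) = F p := by
  let F' : C(ℝ × ℝ, {z : ℂ // z ≠ 0}) := ⟨fun p ↦ ⟨F p, h0 p⟩, by fun_prop⟩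
  obtain ⟨G, ⟨-, hG⟩, -⟩ := Complex.isCoveringMap_exp.existsUnique_continuousMap_lifts F' 0
    (Complex.log (F 0)) (Subtype.ext (Complex.exp_log (h0 0)))
  exact ⟨G, G.continuous, fun p ↦ congrArg Subtype.val (congrFun hG p)⟩

/-- The **Poincaré–Miranda theorem** on the square `[-1, 1]²`. -/
theorem poincare_miranda {u v : ℝ × ℝ → ℝ} (hu : Continuous u) (hv : Continuous v)
    (hl : ∀ t ∈ Icc (-1 : ℝ) 1, u (-1, t) < 0) (hr : ∀ t ∈ Icc (-1 : ℝ) 1, 0 < u (1, t))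
    (hb : ∀ s ∈ Icc (-1 : ℝ) 1, v (s, -1) < 0) (ht : ∀ s ∈ Icc (-1 : ℝ) 1, 0 < v (s, 1)) :
    ∃ p ∈ Icc (-1 : ℝ) 1 ×ˢ Icc (-1 : ℝ) 1, u p = 0 ∧ v p = 0 := by
  by_contra! hcon
  have hpi := Real.pi_pos
  let c : ℝ → ℝ := fun t ↦ projIcc (-1) 1 (by norm_num) t
  have hc : Continuous c := by unfold c; fun_prop
  have hcm : ∀ t, c t ∈ Icc (-1 : ℝ) 1 := fun t ↦ (projIcc (-1) 1 (by norm_num) t).2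
  have hce : ∀ t ∈ Icc (-1 : ℝ) 1, c t = t := fun t ht ↦ by
    simp only [c, projIcc_of_mem _ ht]
  let F : ℝ × ℝ → ℂ := fun p ↦ ⟨u (c p.1, c p.2), v (c p.1, c p.2)⟩
  have hF : Continuous F := by
    have : F = fun p ↦ ((u (c p.1, c p.2) : ℝ) : ℂ) + ((v (c p.1, c p.2) : ℝ) : ℂ) * Complex.I := by
      funext p; apply Complex.ext <;> simp [F]
    rw [this]; fun_prop
  obtain ⟨G, hG, hGF⟩ := exists_continuous_exp_eq hF fun p hp ↦
    hcon (c p.1, c p.2) ⟨hcm _, hcm _⟩ (congrArg Complex.re hp) (congrArg Complex.im hp)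
  have hcos : ∀ s ∈ Icc (-1 : ℝ) 1, ∀ t ∈ Icc (-1 : ℝ) 1,
      u (s, t) = Real.exp (G (s, t)).re * Real.cos (G (s, t)).im := fun s hs t ht ↦ by
    rw [← Complex.exp_re, hGF]; simp [F, hce s hs, hce t ht]
  have hsin : ∀ s ∈ Icc (-1 : ℝ) 1, ∀ t ∈ Icc (-1 : ℝ) 1,
      v (s, t) = Real.exp (G (s, t)).re * Real.sin (G (s, t)).im := fun s hs t ht ↦ by
    rw [← Complex.exp_im, hGF]; simp [F, hce s hs, hce t ht]
  have hm : (-1 : ℝ) ∈ Icc (-1 : ℝ) 1 := by simp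
  have hp : (1 : ℝ) ∈ Icc (-1 : ℝ) 1 := by simp
  obtain ⟨k₁, h₁⟩ := exists_int_abs_sub_lt_of_cos_pos (h := fun t ↦ (G (1, t)).im)
    (by fun_prop) fun t ht ↦ by
      have := hr t ht; rw [hcos _ hp _ ht] at this
      exact pos_of_mul_pos_right this (Real.exp_pos _).le
  obtain ⟨k₂, h₂⟩ := exists_int_abs_sub_lt_of_cos_pos (h := fun s ↦ (G (s, 1)).im - Real.pi / 2)
    (by fun_prop) fun s hs ↦ by
      have := ht s hs; rw [hsin _ hs _ hp] at this
      rw [Real.cos_sub_pi_div_two]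
      exact pos_of_mul_pos_right this (Real.exp_pos _).le
  obtain ⟨k₃, h₃⟩ := exists_int_abs_sub_lt_of_cos_pos (h := fun t ↦ (G (-1, t)).im - Real.pi)
    (by fun_prop) fun t ht ↦ by
      have := hl t ht; rw [hcos _ hm _ ht] at this
      rw [Real.cos_sub_pi]
      have := neg_of_mul_neg_right this (Real.exp_pos _).le
      linarith
  obtain ⟨k₄, h₄⟩ := exists_int_abs_sub_lt_of_cos_pos
    (h := fun s ↦ (G (s, -1)).im - Real.pi - Real.pi / 2) (by fun_prop) fun s hs ↦ by
      have := hb s hs; rw [hsin _ hs _ hm] at this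
      rw [Real.cos_sub_pi_div_two, Real.sin_sub_pi]
      have := neg_of_mul_neg_right this (Real.exp_pos _).le
      linarith
  have key : ∀ {a : ℝ} {k l : ℤ}, 2 * Real.pi * k < 2 * Real.pi * l + Real.pi * a →
      (2 * (k - l) : ℝ) < a := fun {a k l} h ↦ by
    by_contra! hcon
    nlinarith [mul_le_mul_of_nonneg_left hcon hpi.le]
  have c₁ := abs_lt.1 (h₁ 1 hp)
  have c₂ := abs_lt.1 (h₂ 1 hp)
  have c₃ := abs_lt.1 (h₂ (-1) hm)
  have c₄ := abs_lt.1 (h₃ 1 hp)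
  have c₅ := abs_lt.1 (h₃ (-1) hm)
  have c₆ := abs_lt.1 (h₄ (-1) hm)
  have c₇ := abs_lt.1 (h₄ 1 hp)
  have c₈ := abs_lt.1 (h₁ (-1) hm)
  have e₁ : k₁ ≤ k₂ := by
    have := key (a := 3 / 2) (k := k₁) (l := k₂) (by linarith)
    have : ((k₁ : ℝ)) < k₂ + 1 := by linarith
    exact Int.lt_add_one_iff.1 (by exact_mod_cast this)
  have e₂ : k₂ ≤ k₃ := by
    have := key (a := 3 / 2) (k := k₂) (l := k₃) (by linarith)
    have : ((k₂ : ℝ)) < k₃ + 1 := by linarith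
    exact Int.lt_add_one_iff.1 (by exact_mod_cast this)
  have e₃ : k₃ ≤ k₄ := by
    have := key (a := 3 / 2) (k := k₃) (l := k₄) (by linarith)
    have : ((k₃ : ℝ)) < k₄ + 1 := by linarith
    exact Int.lt_add_one_iff.1 (by exact_mod_cast this)
  have e₄ : k₄ < k₁ := by
    have := key (a := - 1 / 2) (k := k₄) (l := k₁) (by linarith)
    have : ((k₄ : ℝ)) < k₁ := by linarith
    exact_mod_cast this
  omega

/-- In a compact Hausdorff space, two closed sets that meet no common connected component are
separated by a clopen set. -/
lemma exists_isClopen_of_forall_disjoint_connectedComponent {X : Type*} [TopologicalSpace X]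
    [T2Space X] [CompactSpace X] {A B : Set X} (hA : IsClosed A) (hB : IsClosed B)
    (hAB : ∀ x ∈ A, Disjoint (connectedComponent x) B) :
    ∃ W : Set X, IsClopen W ∧ A ⊆ W ∧ Disjoint W B := by
  have h1 : ∀ x ∈ A, ∃ s : Set X, IsClopen s ∧ x ∈ s ∧ Disjoint s B := by
    intro x hx
    by_contra! hcon
    have := hB.isCompact.inter_iInter_nonempty
      (fun s : { s : Set X // IsClopen s ∧ x ∈ s } => s.1) (fun s => s.2.1.1) fun u ↦ by
        have hu : IsClopen (⋂ i ∈ u, i.1) := isClopen_biInter_finset fun s _ => s.2.1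
        have := hcon _ hu (mem_iInter₂.2 fun s _ => s.2.2)
        rw [not_disjoint_iff_nonempty_inter, inter_comm] at this
        exact this
    rw [← connectedComponent_eq_iInter_isClopen, inter_comm,
      ← not_disjoint_iff_nonempty_inter] at this
    exact this (hAB x hx)
  choose! s hs hxs hsB using h1
  obtain ⟨t, htA, ht⟩ := hA.isCompact.elim_nhds_subcover s
    fun x hx ↦ (hs x hx).isOpen.mem_nhds (hxs x hx)
  refine ⟨⋃ x ∈ t, s x, t.finite_toSet.isClopen_biUnion fun x hx ↦ hs x (htA x hx), ht, ?_⟩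
  simp only [disjoint_iUnion_left]
  exact fun x hx ↦ hsB x (htA x hx)

/-- If a continuous function on `[-1, 1]²` is negative on the bottom side and positive on the top
side, then a connected subset of its zero set joins the left side to the right side. -/
theorem exists_isPreconnected_zeros {v : ℝ × ℝ → ℝ} (hv : Continuous v)
    (hb : ∀ s ∈ Icc (-1 : ℝ) 1, v (s, -1) < 0) (ht : ∀ s ∈ Icc (-1 : ℝ) 1, 0 < v (s, 1)) :
    ∃ C ⊆ Icc (-1 : ℝ) 1 ×ˢ Icc (-1 : ℝ) 1, IsPreconnected C ∧ (∀ p ∈ C, v p = 0) ∧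
      (∃ p ∈ C, p.1 = -1) ∧ ∃ p ∈ C, p.1 = 1 := by
  let K : Set (ℝ × ℝ) := (Icc (-1 : ℝ) 1 ×ˢ Icc (-1 : ℝ) 1) ∩ v ⁻¹' {0}
  have hK : IsCompact K := (isCompact_Icc.prod isCompact_Icc).inter_right
    (isClosed_singleton.preimage hv)
  have : CompactSpace K := isCompact_iff_compactSpace.1 hK
  let L : Set (ℝ × ℝ) := {p | p.1 = -1}
  let R : Set (ℝ × ℝ) := {p | p.1 = 1}
  have hL : IsClosed L := isClosed_eq (by fun_prop) (by fun_prop)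
  have hR : IsClosed R := isClosed_eq (by fun_prop) (by fun_prop)
  have hLR : Disjoint L R := disjoint_left.2 fun p (h : p.1 = -1) (h' : p.1 = 1) ↦ by linarith
  by_contra! hcon
  obtain ⟨W, hW, hLW, hWR⟩ := exists_isClopen_of_forall_disjoint_connectedComponent
    (A := ((↑) : K → ℝ × ℝ) ⁻¹' L) (B := ((↑) : K → ℝ × ℝ) ⁻¹' R)
    (hL.preimage continuous_subtype_val) (hR.preimage continuous_subtype_val) fun x hx ↦ by
      refine disjoint_left.2 fun y hy hyR ↦ ?_
      refine hcon ((↑) '' connectedComponent x) ?_ ?_ ?_ ⟨x, ⟨x, mem_connectedComponent, rfl⟩, hx⟩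
        y ⟨y, hy, rfl⟩ hyR
      · rintro _ ⟨z, -, rfl⟩; exact z.2.1
      · exact isPreconnected_connectedComponent.image _ continuous_subtype_val.continuousOn
      · rintro _ ⟨z, -, rfl⟩; exact z.2.2
  have hc : Topology.IsClosedEmbedding ((↑) : K → ℝ × ℝ) := hK.isClosed.isClosedEmbedding_subtypeVal
  have hd : Disjoint ((↑) '' W ∪ L) ((↑) '' Wᶜ ∪ R) := by
    simp only [disjoint_union_left, disjoint_union_right]
    refine ⟨⟨?_, ?_⟩, ?_, hLR⟩
    · exact (disjoint_image_iff Subtype.val_injective).2 disjoint_compl_right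
    · rw [disjoint_right]; rintro _ ⟨y, hy, rfl⟩ h; exact hy (hLW h)
    · rw [disjoint_left]; rintro _ ⟨y, hy, rfl⟩ h; exact disjoint_left.1 hWR hy h
  obtain ⟨g, hg0, hg1, -⟩ := exists_continuous_zero_one_of_isClosed
    ((hc.isClosedMap _ hW.1).union hL) ((hc.isClosedMap _ hW.compl.1).union hR) hd
  obtain ⟨p, hp, hgp, hvp⟩ := poincare_miranda (u := fun p ↦ g p - 1 / 2) (by fun_prop) hv
    (fun t _ ↦ by simp [hg0 (x := (-1, t)) (Or.inr rfl)])
    (fun t _ ↦ by norm_num [hg1 (x := (1, t)) (Or.inr rfl)]) hb ht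
  by_cases hpW : (⟨p, hp, hvp⟩ : K) ∈ W
  · norm_num [hg0 (x := p) (Or.inl ⟨_, hpW, rfl⟩)] at hgp
  · norm_num [hg1 (x := p) (Or.inl ⟨_, hpW, rfl⟩)] at hgp

/-- The Eilenberg inequality for a real function that is Lipschitz at small scales: the function
sending `r` to the measure of `A ∩ {f = r}` has a measurable majorant with controlled integral. -/
theorem exists_measurable_ge_hausdorffMeasure_inter_preimage {X : Type*} [EMetricSpace X]
    [MeasurableSpace X] [BorelSpace X] {f : X → ℝ} {A : Set X} {δ : ENNReal} (hδ : 0 < δ)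
    {L : NNReal} (hL : ∀ x ∈ A, ∀ y ∈ A, edist x y ≤ δ → edist (f x) (f y) ≤ L * edist x y)
    {c : ENNReal} (hc : μH[2] A < c) :
    ∃ g : ℝ → ENNReal, Measurable g ∧ (∀ r, μH[1] (A ∩ f ⁻¹' {r}) ≤ g r) ∧
      ∫⁻ r, g r ≤ L * c := by
  let ρ : ℕ → ENNReal := fun n ↦ min δ ((n : ENNReal)⁻¹)
  have hρ : ∀ n, 0 < ρ n := fun n ↦ lt_min hδ (by simp)
  have hρ0 : Tendsto ρ atTop (nhds 0) :=
    tendsto_of_tendsto_of_tendsto_of_le_of_le tendsto_const_nhds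
      ENNReal.tendsto_inv_nat_nhds_zero (fun _ ↦ zero_le) fun _ ↦ min_le_right _ _
  have hcov : ∀ n, ∃ t : ℕ → Set X, A ⊆ ⋃ i, t i ∧ (∀ i, ediam (t i) ≤ ρ n) ∧
      ∑' i, ediam (t i) ^ (2 : ℝ) < c := by
    intro n
    rw [Measure.hausdorffMeasure_apply] at hc
    have h1 := lt_of_le_of_lt (le_iSup₂ (α := ENNReal) (ρ n) (hρ n)) hc
    simp only [iInf_lt_iff] at h1
    obtain ⟨t, hA, hd, hs⟩ := h1
    refine ⟨t, hA, hd, lt_of_le_of_lt (ENNReal.tsum_le_tsum fun i ↦ ?_) hs⟩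
    rcases (t i).eq_empty_or_nonempty with h | h
    · simp [h]
    · simp [h]
  choose t htA htd hts using hcov
  let T : ℕ → ℕ → Set ℝ := fun n i ↦ toMeasurable volume (f '' (A ∩ t n i))
  have hT : ∀ n i, volume (T n i) ≤ L * ediam (t n i) := fun n i ↦ by
    rw [measure_toMeasurable]
    refine (Real.volume_le_diam _).trans (ediam_le ?_)
    rintro _ ⟨x, hx, rfl⟩ _ ⟨y, hy, rfl⟩
    have h1 := edist_le_ediam_of_mem hx.2 hy.2
    exact (hL x hx.1 y hy.1 (h1.trans ((htd n i).trans (min_le_left _ _)))).trans (by gcongr)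
  let g : ℕ → ℝ → ENNReal := fun n r ↦ ∑' i, (T n i).indicator (fun _ ↦ ediam (t n i)) r
  have hTm : ∀ n i, Measurable ((T n i).indicator fun _ ↦ ediam (t n i)) := fun n i ↦
    measurable_const.indicator (measurableSet_toMeasurable _ _)
  have hg : ∀ n, Measurable (g n) := fun n ↦ Measurable.tsum (hTm n)
  refine ⟨fun r ↦ liminf (fun n ↦ g n r) atTop, Measurable.liminf hg, fun r ↦ ?_, ?_⟩
  · refine (Measure.hausdorffMeasure_le_liminf_tsum 1 _ ρ hρ0
      (fun n i ↦ {x ∈ t n i | x ∈ A ∧ f x = r}) ?_ ?_).trans ?_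
    · exact Eventually.of_forall fun n i ↦ (ediam_mono (sep_subset _ _)).trans (htd n i)
    · refine Eventually.of_forall fun n x hx ↦ ?_
      obtain ⟨i, hi⟩ := mem_iUnion.1 (htA n hx.1)
      exact mem_iUnion.2 ⟨i, hi, hx.1, hx.2⟩
    · refine liminf_le_liminf (Eventually.of_forall fun n ↦ ENNReal.tsum_le_tsum fun i ↦ ?_)
      rw [ENNReal.rpow_one]
      rcases Set.eq_empty_or_nonempty {x ∈ t n i | x ∈ A ∧ f x = r} with h | ⟨x, hx, hxA, rfl⟩
      · simp [h]
      · rw [indicator_of_mem (subset_toMeasurable _ _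
          (mem_image_of_mem f (show x ∈ A ∩ t n i from ⟨hxA, hx⟩)))]
        exact ediam_mono (sep_subset _ _)
  · refine (lintegral_liminf_le hg).trans ?_
    refine (liminf_le_liminf (Eventually.of_forall fun n ↦ ?_)).trans
      (liminf_const (f := atTop (α := ℕ)) ((L : ENNReal) * c)).le
    show ∫⁻ r, g n r ≤ L * c
    rw [lintegral_tsum fun i ↦ (hTm n i).aemeasurable]
    calc _ = ∑' i, ediam (t n i) * volume (T n i) := by
          congr 1; ext i
          rw [lintegral_indicator_const (measurableSet_toMeasurable _ _)]
      _ ≤ ∑' i, L * ediam (t n i) ^ (2 : ℝ) := ENNReal.tsum_le_tsum fun i ↦ by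
          calc _ ≤ ediam (t n i) * (L * ediam (t n i)) := by gcongr; exact hT n i
            _ = _ := by rw [ENNReal.rpow_two]; ring
      _ ≤ L * c := by rw [ENNReal.tsum_mul_left]; gcongr; exact (hts n).le

/-- A function with measurable majorants of arbitrarily small integral vanishes almost everywhere. -/
lemma ae_eq_zero_of_forall_exists_measurable_ge {α : Type*} [MeasurableSpace α] {μ : Measure α}
    {h : α → ENNReal} (hh : ∀ ε : ENNReal, 0 < ε →
      ∃ g : α → ENNReal, Measurable g ∧ (∀ a, h a ≤ g a) ∧ ∫⁻ a, g a ∂μ ≤ ε) :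
    ∀ᵐ a ∂μ, h a = 0 := by
  choose g hgm hg hgi using fun n : ℕ ↦ hh ((n : ENNReal)⁻¹) (by simp)
  have h0 : ∫⁻ a, ⨅ n, g n a ∂μ = 0 := by
    refine le_antisymm (ge_of_tendsto' ENNReal.tendsto_inv_nat_nhds_zero fun n ↦ ?_) zero_le
    exact (lintegral_mono fun a ↦ iInf_le (fun n ↦ g n a) n).trans (hgi n)
  filter_upwards [(lintegral_eq_zero_iff (Measurable.iInf hgm)).1 h0] with a ha
  exact le_antisymm ((le_iInf fun n ↦ hg n a).trans ha.le) zero_le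

/-- On a set of null two-dimensional measure, almost every level set of a Lipschitz function is
null. -/
theorem LipschitzWith.ae_hausdorffMeasure_inter_preimage_eq_zero {X : Type*} [EMetricSpace X]
    [MeasurableSpace X] [BorelSpace X] {f : X → ℝ} {K : NNReal} (hf : LipschitzWith K f)
    {A : Set X} (hA : μH[2] A = 0) : ∀ᵐ r : ℝ, μH[1] (A ∩ f ⁻¹' {r}) = 0 := by
  refine ae_eq_zero_of_forall_exists_measurable_ge fun ε hε ↦ ?_
  obtain ⟨η, hη, hηε⟩ : ∃ η : ENNReal, 0 < η ∧ K * η ≤ ε := by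
    rcases eq_or_ne K 0 with rfl | hK
    · exact ⟨1, one_pos, by simp⟩
    · exact ⟨ε / K, ENNReal.div_pos hε.ne' (by simp), ENNReal.mul_div_le⟩
  obtain ⟨g, hgm, hg, hgi⟩ := exists_measurable_ge_hausdorffMeasure_inter_preimage
    (δ := 1) one_pos (A := A) (c := η) (fun x _ y _ _ ↦ hf x y) (hA ▸ hη)
  exact ⟨g, hgm, hg, hgi.trans hηε⟩

/-- On a set of critical points, almost every level set is null. -/
theorem ae_hausdorffMeasure_inter_preimage_eq_zero_of_hasFDerivAt {E : Type*}
    [NormedAddCommGroup E] [NormedSpace ℝ E] [MeasurableSpace E] [BorelSpace E] {f : E → ℝ}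
    {S : Set E} (hS : μH[2] S ≠ ⊤) (hf : ∀ x ∈ S, HasFDerivAt f (0 : E →L[ℝ] ℝ) x) :
    ∀ᵐ r : ℝ, μH[1] (S ∩ f ⁻¹' {r}) = 0 := by
  refine ae_eq_zero_of_forall_exists_measurable_ge fun ε hε ↦ ?_
  obtain ⟨L, hL, hLε⟩ : ∃ L : NNReal, 0 < L ∧ L * (μH[2] S + 1) ≤ ε := by
    have h1 : 0 < ε / (μH[2] S + 1) := ENNReal.div_pos hε.ne' (by simp [hS])
    obtain ⟨L, hL, hL'⟩ := ENNReal.lt_iff_exists_nnreal_btwn.1 h1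
    exact ⟨L, by exact_mod_cast hL, ENNReal.mul_le_of_le_div hL'.le⟩
  let s : ℕ → Set E := fun n ↦
    {x ∈ S | ∀ y, edist x y ≤ ((n : ENNReal) + 1)⁻¹ → edist (f x) (f y) ≤ L * edist x y}
  have hmono : Monotone s := fun m n hmn x hx ↦
    ⟨hx.1, fun y hy ↦ hx.2 y (hy.trans (by gcongr))⟩
  have hU : S = ⋃ n, s n := by
    refine Subset.antisymm (fun x hx ↦ ?_) (iUnion_subset fun n ↦ sep_subset _ _)
    have h1 := (hf x hx).isLittleO.def (NNReal.coe_pos.2 hL)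
    obtain ⟨δ, hδ, hb⟩ := Metric.nhds_basis_eball.eventually_iff.1 h1
    obtain ⟨n, hn⟩ := ENNReal.exists_inv_nat_lt hδ.ne'
    refine mem_iUnion.2 ⟨n, hx, fun y hy ↦ ?_⟩
    have h2 := @hb y (by
      rw [mem_eball, edist_comm]
      exact lt_of_le_of_lt (hy.trans (ENNReal.inv_le_inv.2 le_self_add)) hn)
    simp only [_root_.zero_apply, sub_zero] at h2
    rw [edist_comm (f x), edist_comm x, edist_dist, edist_dist, dist_eq_norm, dist_eq_norm,
      ← ENNReal.ofReal_coe_nnreal, ← ENNReal.ofReal_mul L.coe_nonneg]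
    exact ENNReal.ofReal_le_ofReal h2
  have hlt : ∀ n, μH[2] (s n) < μH[2] S + 1 := fun n ↦
    (measure_mono (sep_subset _ _)).trans_lt (ENNReal.lt_add_right hS one_ne_zero)
  choose g hgm hg hgi using fun n ↦ exists_measurable_ge_hausdorffMeasure_inter_preimage
    (f := f) (A := s n) (δ := ((n : ENNReal) + 1)⁻¹) (by simp) (fun x hx y _ h ↦ hx.2 y h) (hlt n)
  refine ⟨fun r ↦ liminf (fun n ↦ g n r) atTop, Measurable.liminf hgm, fun r ↦ ?_, ?_⟩
  · have hm : Monotone fun n ↦ s n ∩ f ⁻¹' {r} := fun m n hmn ↦ inter_subset_inter_left _ (hmono hmn)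
    have h1 : μH[1] (S ∩ f ⁻¹' {r}) = ⨆ n, μH[1] (s n ∩ f ⁻¹' {r}) := by
      conv_lhs => rw [hU, iUnion_inter]
      exact hm.directed_le.measure_iUnion
    rw [h1, ← (tendsto_atTop_iSup fun m n hmn ↦ measure_mono (hm hmn)).liminf_eq]
    exact liminf_le_liminf (Eventually.of_forall fun n ↦ hg n r)
  · refine (lintegral_liminf_le hgm).trans ?_
    exact (liminf_le_liminf (Eventually.of_forall fun n ↦ (hgi n).trans hLε)).trans
      (liminf_const (f := atTop (α := ℕ)) ε).le

/-- A set which is null for a finite measure `ν`, and at each point of which `ν` has positive lower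
one-dimensional density, is `μH[1]`-null. -/
theorem hausdorffMeasure_eq_zero_of_density {X : Type*} [MetricSpace X]
    [TopologicalSpace.SeparableSpace X] [MeasurableSpace X] [BorelSpace X] {ν : Measure X}
    [IsFiniteMeasure ν] {A : Set X} (hA : ν A = 0) {c : ENNReal} (hc : c ≠ ⊤)
    (hd : ∀ x ∈ A, ∀ᶠ R in nhdsWithin 0 (Ioi (0 : ℝ)),
      ENNReal.ofReal R ≤ c * ν (closedBall x R)) :
    μH[1] A = 0 := by
  have key : ∀ ε : ENNReal, 0 < ε → μH[1] A ≤ 10 * c * ε := by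
    intro ε hε
    obtain ⟨U, hAU, hU, hνU⟩ := A.exists_isOpen_lt_of_lt ε (by rwa [hA])
    let t : ℕ → Set (X × ℝ) := fun n ↦ {p | 0 < p.2 ∧ p.2 ≤ (n + 1 : ℝ)⁻¹ ∧
      closedBall p.1 p.2 ⊆ U ∧ ENNReal.ofReal p.2 ≤ c * ν (closedBall p.1 p.2)}
    have ht : ∀ n, ∀ x ∈ A, ∃ R, (x, R) ∈ t n := fun n x hx ↦ by
      have h1 : ∀ᶠ R in nhdsWithin 0 (Ioi (0 : ℝ)), closedBall x R ⊆ U :=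
        (eventually_closedBall_subset (hU.mem_nhds (hAU hx))).filter_mono nhdsWithin_le_nhds
      have h2 : ∀ᶠ R in nhdsWithin 0 (Ioi (0 : ℝ)), R ≤ (n + 1 : ℝ)⁻¹ :=
        nhdsWithin_le_nhds (Iic_mem_nhds (by positivity : (0 : ℝ) < (n + 1 : ℝ)⁻¹))
      obtain ⟨R, h1, h2, h3, h4⟩ := (h1.and (h2.and ((hd x hx).and self_mem_nhdsWithin))).exists
      exact ⟨R, h4, h2, h1, h3⟩
    choose u hut hdisj hcov using fun n ↦
      Vitali.exists_disjoint_subfamily_covering_enlargement_closedBall (t n) Prod.fst Prod.snd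
        ((n + 1 : ℝ)⁻¹) (fun a ha ↦ ha.2.1) 5 (by norm_num)
    have hcount : ∀ n, (u n).Countable := fun n ↦
      (hdisj n).countable_of_nonempty_interior fun a ha ↦
        ⟨a.1, ball_subset_interior_closedBall (mem_ball_self (hut n ha).1)⟩
    have : ∀ n, Countable (u n) := fun n ↦ (hcount n).to_subtype
    have hdiam : ∀ n, ∀ a ∈ u n, ediam (closedBall a.1 (5 * a.2)) ≤ 10 * ENNReal.ofReal a.2 := by
      intro n a ha
      have h0 := (hut n ha).1
      rw [← Metric.closedEBall_ofReal (by linarith)]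
      refine Metric.ediam_closedEBall_le.trans ?_
      rw [ENNReal.ofReal_mul (by norm_num), ← mul_assoc]
      norm_num
    refine (Measure.hausdorffMeasure_le_liminf_tsum 1 A
      (fun n : ℕ ↦ 10 * ENNReal.ofReal ((n + 1 : ℝ)⁻¹)) (l := atTop) ?_
      (fun n (a : u n) ↦ closedBall a.1.1 (5 * a.1.2)) ?_ ?_).trans ?_
    · have h1 : Tendsto (fun n : ℕ ↦ (n + 1 : ℝ)⁻¹) atTop (nhds 0) := by
        simpa using tendsto_one_div_add_atTop_nhds_zero_nat (𝕜 := ℝ)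
      simpa using ENNReal.Tendsto.const_mul (ENNReal.tendsto_ofReal h1) (a := 10)
        (Or.inr (by simp))
    · refine Eventually.of_forall fun n a ↦ (hdiam n a a.2).trans ?_
      gcongr
      exact (hut n a.2).2.1
    · refine Eventually.of_forall fun n x hx ↦ ?_
      obtain ⟨R, hR⟩ := ht n x hx
      obtain ⟨b, hb, hsub⟩ := hcov n _ hR
      exact mem_iUnion.2 ⟨⟨b, hb⟩, hsub (mem_closedBall_self hR.1.le)⟩
    · refine (liminf_le_liminf (Eventually.of_forall fun n ↦ ?_)).trans
        (liminf_const (f := atTop (α := ℕ)) (10 * c * ε)).le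
      calc ∑' a : u n, ediam (closedBall a.1.1 (5 * a.1.2)) ^ (1 : ℝ)
          ≤ ∑' a : u n, 10 * c * ν (closedBall a.1.1 a.1.2) := ENNReal.tsum_le_tsum fun a ↦ by
            rw [ENNReal.rpow_one, mul_assoc]
            exact (hdiam n a a.2).trans (by gcongr; exact (hut n a.2).2.2.2)
        _ = 10 * c * ν (⋃ a ∈ u n, closedBall a.1 a.2) := by
            rw [ENNReal.tsum_mul_left, measure_biUnion (hcount n) (hdisj n)
              fun a _ ↦ isClosed_closedBall.measurableSet]
        _ ≤ 10 * c * ε := by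
            gcongr
            exact (measure_mono (iUnion₂_subset fun a ha ↦ (hut n ha).2.2.1)).trans hνU.le
  refine le_antisymm (ge_of_tendsto' (x := atTop) (f := fun n : ℕ ↦ 10 * c * (n : ENNReal)⁻¹) ?_
    fun n ↦ key _ (by simp)) zero_le
  simpa using ENNReal.Tendsto.const_mul ENNReal.tendsto_inv_nat_nhds_zero (a := 10 * c)
    (Or.inr (ENNReal.mul_ne_top (by simp) hc))

lemma IsClosed.isClosed_connectedComponentIn {X : Type*} [TopologicalSpace X] {F : Set X}
    (hF : IsClosed F) (x : X) : IsClosed (connectedComponentIn F x) := by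
  by_cases hx : x ∈ F
  · rw [connectedComponentIn_eq_image hx]
    exact hF.isClosedEmbedding_subtypeVal.isClosedMap _ isClosed_connectedComponent
  · simp [connectedComponentIn_eq_empty hx]

/-- The one-dimensional Hausdorff measure of a connected set is at least its diameter. -/
lemma IsPreconnected.edist_le_hausdorffMeasure {X : Type*} [MetricSpace X] [MeasurableSpace X]
    [BorelSpace X] {C : Set X} (hC : IsPreconnected C) {p q : X} (hp : p ∈ C) (hq : q ∈ C) :
    edist p q ≤ μH[1] C := by
  have h1 := (hC.image (dist p) (by fun_prop)).Icc_subset (mem_image_of_mem _ hp)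
    (mem_image_of_mem _ hq)
  rw [dist_self] at h1
  have h2 := (LipschitzWith.dist_right p).hausdorffMeasure_image_le zero_le_one C
  rw [ENNReal.coe_one, ENNReal.one_rpow, one_mul] at h2
  calc edist p q = volume (Icc 0 (dist p q)) := by rw [Real.volume_Icc, sub_zero, edist_dist]
    _ = μH[1] (Icc 0 (dist p q)) := by rw [hausdorffMeasure_real]
    _ ≤ _ := (measure_mono h1).trans h2

/-- Near a regular point of `f`, the nondegenerate components of the level set through this point
have positive one-dimensional density. -/
theorem eventually_le_hausdorffMeasure_inter_closedBall {E : Type*} [NormedAddCommGroup E]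
    [NormedSpace ℝ E] [FiniteDimensional ℝ E] (hE : 1 < Module.finrank ℝ E) [MeasurableSpace E]
    [BorelSpace E] {f : E → ℝ} (hf : Continuous f) {f' : E →L[ℝ] ℝ} {x : E}
    (hx : HasFDerivAt f f' x) (hf' : f' ≠ 0) :
    ∀ᶠ R in nhdsWithin 0 (Ioi (0 : ℝ)), ENNReal.ofReal R ≤
      2 * μH[1] ({y ∈ f ⁻¹' {f x} | 0 < μH[1] (connectedComponentIn (f ⁻¹' {f x}) y)} ∩
        closedBall x R) := by
  obtain ⟨w, hw, hw1⟩ : ∃ w, f' w = 0 ∧ ‖w‖ = 1 := by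
    obtain ⟨w, hw, hw0⟩ := (Submodule.ne_bot_iff _).1
      (LinearMap.ker_ne_bot_of_finrank_lt (f := f'.toLinearMap) (by simpa using hE))
    exact ⟨(‖w‖⁻¹ : ℝ) • w, by rw [map_smul, show f' w = 0 from hw, smul_zero], by
      rw [norm_smul, norm_inv, norm_norm, inv_mul_cancel₀ (norm_ne_zero_iff.2 hw0)]⟩
  obtain ⟨v, hv, hv1⟩ : ∃ v, 0 < f' v ∧ ‖v‖ ≤ 1 / 2 := by
    obtain ⟨v, hv⟩ := DFunLike.ne_iff.1 hf'
    rw [_root_.zero_apply] at hv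
    have hv0 : 0 < ‖v‖ := norm_pos_iff.2 fun h ↦ hv (by simp [h])
    refine ⟨(f' v * (|f' v|⁻¹ * ‖v‖⁻¹ / 2)) • v, ?_, ?_⟩
    · rw [map_smul, smul_eq_mul]
      have := abs_pos.2 hv
      have := mul_self_pos.2 hv
      have : 0 < (f' v * f' v) * (|f' v|⁻¹ * ‖v‖⁻¹ / 2) := by positivity
      linarith
    · rw [norm_smul, Real.norm_eq_abs, abs_mul,
        abs_of_pos (by positivity : 0 < |f' v|⁻¹ * ‖v‖⁻¹ / 2)]
      have := abs_pos.2 hv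
      field_simp
      exact le_refl _
  obtain ⟨R₀, hR₀, hb⟩ := Metric.nhds_basis_closedBall.eventually_iff.1
    (hx.isLittleO.def (by positivity : 0 < f' v / 4))
  filter_upwards [Ioc_mem_nhdsGT hR₀] with R hR
  obtain ⟨ρ, rfl⟩ : ∃ ρ, R = 2 * ρ := ⟨R / 2, by ring⟩
  have hρ : 0 < ρ := by linarith [hR.1]
  let Φ : ℝ × ℝ → E := fun p ↦ x + ρ • (p.1 • w + p.2 • v)
  have hΦ : Continuous Φ := by unfold Φ; fun_prop
  have hΦx : ∀ p ∈ Icc (-1 : ℝ) 1 ×ˢ Icc (-1 : ℝ) 1, ‖Φ p - x‖ ≤ 2 * ρ := by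
    intro p hp
    have h1 : ‖p.1 • w + p.2 • v‖ ≤ 1 * 1 + 1 * (1 / 2) := (norm_add_le _ _).trans (by
      rw [norm_smul, norm_smul, hw1]
      gcongr
      · exact abs_le.2 hp.1
      · exact abs_le.2 hp.2)
    simp only [Φ, add_sub_cancel_left, norm_smul, Real.norm_eq_abs, abs_of_pos hρ]
    nlinarith
  have hfΦ : ∀ p ∈ Icc (-1 : ℝ) 1 ×ˢ Icc (-1 : ℝ) 1,
      |f (Φ p) - f x - ρ * (p.2 * f' v)| ≤ f' v / 4 * (2 * ρ) := by
    intro p hp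
    have h1 := @hb (Φ p) (mem_closedBall_iff_norm.2 ((hΦx p hp).trans hR.2))
    have h2 : f' (Φ p - x) = ρ * (p.2 * f' v) := by simp [Φ, hw]
    rw [h2, Real.norm_eq_abs] at h1
    exact h1.trans (by gcongr; exact hΦx p hp)
  have hfv : 0 < ρ * f' v := by positivity
  obtain ⟨C, hCQ, hC, hC0, ⟨p, hp, hp1⟩, q, hq, hq1⟩ := exists_isPreconnected_zeros
    (v := fun p ↦ f (Φ p) - f x) (by fun_prop)
    (fun s hs ↦ by
      have := (abs_le.1 (hfΦ (s, -1) ⟨hs, by simp⟩)).2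
      simp only at this ⊢
      linarith)
    (fun s hs ↦ by
      have := (abs_le.1 (hfΦ (s, 1) ⟨hs, by simp⟩)).1
      simp only at this ⊢
      linarith)
  have hC' : IsPreconnected (Φ '' C) := hC.image _ hΦ.continuousOn
  have hCf : Φ '' C ⊆ f ⁻¹' {f x} := by
    rintro _ ⟨y, hy, rfl⟩; exact sub_eq_zero.1 (hC0 y hy)
  have hdist : ENNReal.ofReal ρ ≤ μH[1] (Φ '' C) := by
    refine le_trans ?_ (hC'.edist_le_hausdorffMeasure (mem_image_of_mem _ hp)
      (mem_image_of_mem _ hq))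
    rw [edist_dist, dist_comm, dist_eq_norm]
    refine ENNReal.ofReal_le_ofReal ?_
    have h1 : Φ q - Φ p = ρ • ((2 : ℝ) • w - (p.2 - q.2) • v) := by
      simp only [Φ, hp1, hq1]; module
    have h2 : ‖(p.2 - q.2) • v‖ ≤ 2 * (1 / 2) := by
      rw [norm_smul]
      gcongr
      exact abs_le.2 ⟨by linarith [(hCQ hp).2.1, (hCQ hq).2.2],
        by linarith [(hCQ hp).2.2, (hCQ hq).2.1]⟩
    have h3 : ‖(2 : ℝ) • w‖ = 2 := by rw [norm_smul, hw1]; norm_num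
    have h4 := norm_sub_norm_le ((2 : ℝ) • w) ((p.2 - q.2) • v)
    rw [h1, norm_smul, Real.norm_eq_abs, abs_of_pos hρ]
    nlinarith
  rw [ENNReal.ofReal_mul zero_le_two, ENNReal.ofReal_ofNat]
  gcongr
  refine hdist.trans (measure_mono ?_)
  intro y hy
  refine ⟨⟨hCf hy, ?_⟩, ?_⟩
  · exact (ENNReal.ofReal_pos.2 hρ).trans_le
      (hdist.trans (measure_mono (hC'.subset_connectedComponentIn hy hCf)))
  · obtain ⟨z, hz, rfl⟩ := hy
    exact mem_closedBall_iff_norm.2 (hΦx z (hCQ hz))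

/-- A closed set of finite one-dimensional Hausdorff measure has countably many components of
positive measure. -/
lemma countable_connectedComponentIn_hausdorffMeasure_pos {X : Type*} [EMetricSpace X]
    [MeasurableSpace X] [BorelSpace X] {F : Set X} (hF : IsClosed F) (hfin : μH[1] F ≠ ⊤) :
    {C : Set X | (∃ x ∈ F, C = connectedComponentIn F x) ∧ 0 < μH[1] C}.Countable := by
  let S : Set (Set X) := {C | ∃ x ∈ F, C = connectedComponentIn F x}
  have h1 : Set.Countable {C : S | 0 < μH[1] C.1} := by
    refine Measure.countable_meas_pos_of_disjoint_of_meas_iUnion_ne_top μH[1] ?_ ?_ ?_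
    · rintro ⟨_, x, hx, rfl⟩
      exact (hF.isClosed_connectedComponentIn x).measurableSet
    · rintro ⟨_, x, hx, rfl⟩ ⟨_, y, hy, rfl⟩ hne
      refine disjoint_left.2 fun z hzx hzy ↦ hne (Subtype.ext ?_)
      exact (connectedComponentIn_eq hzx).trans (connectedComponentIn_eq hzy).symm
    · refine ne_top_of_le_ne_top hfin (measure_mono (iUnion_subset ?_))
      rintro ⟨_, x, hx, rfl⟩
      exact connectedComponentIn_subset _ _
  refine (h1.image Subtype.val).mono ?_
  rintro C ⟨hC, hpos⟩
  exact ⟨⟨C, hC⟩, hpos, rfl⟩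

/-- The top-dimensional Hausdorff measure of a Euclidean space is controlled by its volume. -/
lemma EuclideanSpace.exists_hausdorffMeasure_le_mul_volume (ι : Type*) [Fintype ι] :
    ∃ c : NNReal, ∀ A : Set (EuclideanSpace ℝ ι), μH[Fintype.card ι] A ≤ c * volume A := by
  obtain ⟨K, hK⟩ : ∃ K, AntilipschitzWith K (WithLp.ofLp : EuclideanSpace ℝ ι → ι → ℝ) :=
    ⟨_, PiLp.antilipschitzWith_ofLp 2 fun _ : ι ↦ ℝ⟩
  refine ⟨K ^ (Fintype.card ι : ℝ), fun A ↦ ?_⟩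
  have h1 := hK.hausdorffMeasure_preimage_le (d := Fintype.card ι) (by positivity)
    (WithLp.ofLp '' A)
  have h2 := (EuclideanSpace.volume_preserving_symm_measurableEquiv_toLp ι).measure_preimage_equiv
    (WithLp.ofLp '' A)
  have h3 : WithLp.ofLp ⁻¹' (WithLp.ofLp '' A) = A := (WithLp.ofLp_injective 2).preimage_image A
  rw [h3, hausdorffMeasure_pi_real, ← h2] at h1
  rw [ENNReal.coe_rpow_of_nonneg _ (by positivity)]
  exact h1.trans_eq (congrArg (fun B ↦ _ * volume B) h3)

/-- structure of level sets of Lipschitz maps. For a compactly supported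
Lipschitz `f : ℝ² → ℝ` and a.e. `r`: the level set `E_r = f⁻¹(r)` has finite `H¹` measure,
the family of its connected components of positive `H¹` measure is countable, and
`H¹(E_r \ E_r^⋆) = 0`, where `E_r^⋆` is the union of those components. -/
theorem stmt16 (f : E2 → ℝ) (K : NNReal) (hf : LipschitzWith K f)
    (hsupp : HasCompactSupport f) :
    ∀ᵐ r ∂(volume : Measure ℝ),
      μH[1] (f ⁻¹' {r}) < ⊤ ∧
      {C : Set E2 | (∃ x ∈ f ⁻¹' {r}, C = connectedComponentIn (f ⁻¹' {r}) x) ∧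
        0 < μH[1] C}.Countable ∧
      μH[1] ((f ⁻¹' {r}) \
        {y ∈ f ⁻¹' {r} | 0 < μH[1] (connectedComponentIn (f ⁻¹' {r}) y)}) = 0 := by
  have hfc := hf.continuous
  obtain ⟨c, hc⟩ : ∃ c : NNReal, ∀ A : Set E2, μH[2] A ≤ c * volume A := by
    simpa using EuclideanSpace.exists_hausdorffMeasure_le_mul_volume (Fin 2)
  have hT : μH[2] (tsupport f) < ⊤ := (hc _).trans_lt
    (ENNReal.mul_lt_top ENNReal.coe_lt_top hsupp.isCompact.measure_lt_top)
  obtain ⟨g, hgm, hg, hgi⟩ := exists_measurable_ge_hausdorffMeasure_inter_preimage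
    (f := f) one_pos (fun x _ y _ _ ↦ hf x y) (ENNReal.lt_add_right hT.ne one_ne_zero)
  have hgfin : ∀ᵐ r, g r < ⊤ := ae_lt_top hgm (ne_top_of_le_ne_top
    (ENNReal.mul_ne_top ENNReal.coe_ne_top (ENNReal.add_ne_top.2 ⟨hT.ne, ENNReal.one_ne_top⟩)) hgi)
  have hnull : ∀ᵐ r : ℝ, μH[1] ({x | ¬ DifferentiableAt ℝ f x} ∩ f ⁻¹' {r}) = 0 :=
    hf.ae_hausdorffMeasure_inter_preimage_eq_zero
      (le_antisymm ((hc _).trans (by rw [ae_iff.1 hf.ae_differentiableAt, mul_zero])) zero_le)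
  have hcrit := ae_hausdorffMeasure_inter_preimage_eq_zero_of_hasFDerivAt
    (f := f) (S := {x ∈ tsupport f | HasFDerivAt f (0 : E2 →L[ℝ] ℝ) x})
    (ne_top_of_le_ne_top hT.ne (measure_mono (sep_subset _ _))) fun x hx ↦ hx.2
  have h0 : ∀ᵐ r : ℝ, r ≠ 0 := by simp [ae_iff]
  filter_upwards [hgfin, hnull, hcrit, h0] with r hgr hnr hcr hr
  have hsub : f ⁻¹' {r} ⊆ tsupport f := fun x (hx : f x = r) ↦
    subset_tsupport f (Function.mem_support.2 (hx ▸ hr))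
  have hfin : μH[1] (f ⁻¹' {r}) < ⊤ := by
    have := hg r
    rw [inter_eq_right.2 hsub] at this
    exact this.trans_lt hgr
  have hclosed : IsClosed (f ⁻¹' {r}) := isClosed_singleton.preimage hfc
  have hcount := countable_connectedComponentIn_hausdorffMeasure_pos hclosed hfin.ne
  refine ⟨hfin, hcount, ?_⟩
  set S : Set E2 := {y ∈ f ⁻¹' {r} | 0 < μH[1] (connectedComponentIn (f ⁻¹' {r}) y)} with hS
  have hSm : MeasurableSet S := by
    have : S = ⋃₀ {C : Set E2 | (∃ x ∈ f ⁻¹' {r}, C = connectedComponentIn (f ⁻¹' {r}) x) ∧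
        0 < μH[1] C} := by
      ext y
      constructor
      · rintro ⟨hy, hpos⟩
        exact ⟨_, ⟨⟨y, hy, rfl⟩, hpos⟩, mem_connectedComponentIn hy⟩
      · rintro ⟨_, ⟨⟨x, hx, rfl⟩, hpos⟩, hy⟩
        refine ⟨connectedComponentIn_subset _ _ hy, ?_⟩
        rwa [← connectedComponentIn_eq hy]
    rw [this]
    refine MeasurableSet.sUnion hcount ?_
    rintro _ ⟨⟨x, hx, rfl⟩, -⟩
    exact (hclosed.isClosed_connectedComponentIn x).measurableSet
  have : IsFiniteMeasure ((μH[1] : Measure E2).restrict S) := ⟨by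
    rw [Measure.restrict_apply_univ]
    exact (measure_mono (sep_subset _ _)).trans_lt hfin⟩
  let G : Set E2 := {x ∈ f ⁻¹' {r} \ S | DifferentiableAt ℝ f x ∧ fderiv ℝ f x ≠ 0}
  have hG : μH[1] G = 0 := by
    refine hausdorffMeasure_eq_zero_of_density (ν := (μH[1] : Measure E2).restrict S) (c := 2)
      ?_ (by simp) fun x hx ↦ ?_
    · rw [Measure.restrict_apply' hSm, disjoint_iff_inter_eq_empty.1
        (disjoint_left.2 fun x hx hxS ↦ hx.1.2 hxS), measure_empty]
    · obtain rfl : f x = r := hx.1.1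
      filter_upwards [eventually_le_hausdorffMeasure_inter_closedBall (by simp) hfc
        hx.2.1.hasFDerivAt hx.2.2] with R hR
      rwa [Measure.restrict_apply' hSm, inter_comm]
  refine measure_mono_null (fun x hx ↦ ?_) (measure_union_null hG (measure_union_null hnr hcr))
  by_cases hd : DifferentiableAt ℝ f x
  · by_cases hz : fderiv ℝ f x = 0
    · exact Or.inr (Or.inr ⟨⟨hsub hx.1, hz ▸ hd.hasFDerivAt⟩, hx.1⟩)
    · exact Or.inl ⟨hx, hd, hz⟩
  · exact Or.inr (Or.inl ⟨hd, hx.1⟩)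
end

section
/- Let γ : [0,T] → ℝ² be Lipschitz with γ'(t) = b(γ(t)) for a.e. t, where b is Borel, and suppose there exists an injective Lipschitz ĝ : [0,T] → ℝ² with γ([0,T]) ⊆ ĝ([0,T]) and ĝ'(t) = b(ĝ(t)) a.e. Assume 1/|b| ∈ L¹_loc(H¹⌞γ([0,T])). Then for all 0 ≤ t₀ ≤ t ≤ T: ∫_{γ((t₀,t))} dH¹(w)/|b(w)| = (t − t₀) − L¹({ τ ∈ (t₀,t) : γ'(τ) = 0 }). -/
open MeasureTheory Set Metric Filter

local notation "E2" => EuclideanSpace ℝ (Fin 2)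

open scoped NNReal ENNReal Topology

section AreaFormula

variable {F : Type*} [NormedAddCommGroup F] [NormedSpace ℝ F]
  [MeasurableSpace F] [BorelSpace F]

theorem hausdorffMeasure_image_le_of_approximatesLinearOn {f : ℝ → F} {A : ℝ →L[ℝ] F} {s : Set ℝ}
    {δ : ℝ≥0} (h : ApproximatesLinearOn f A s δ) :
    μH[1] (f '' s) ≤ (‖A‖₊ + δ : ℝ≥0) * volume s := by
  have hl : LipschitzOnWith (‖A‖₊ + δ) f s := by
    rw [lipschitzOnWith_iff_restrict]
    exact h.lipschitz
  simpa [hausdorffMeasure_real] using hl.hausdorffMeasure_image_le (d := 1) zero_le_one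

theorem le_hausdorffMeasure_image_of_approximatesLinearOn {f : ℝ → F} {v : F} {s : Set ℝ}
    {δ : ℝ≥0} (h : ApproximatesLinearOn f (ContinuousLinearMap.toSpanSingleton ℝ v) s δ) :
    (‖v‖₊ - δ : ℝ≥0) * volume s ≤ μH[1] (f '' s) := by
  rcases le_or_gt ‖v‖₊ δ with hv | hv
  · simp [tsub_eq_zero_of_le hv]
  have hpos : 0 < ‖v‖₊ - δ := tsub_pos_of_lt hv
  have key : ∀ x ∈ s, ∀ y ∈ s, ((‖v‖₊ - δ : ℝ≥0) : ℝ) * dist x y ≤ dist (f x) (f y) := by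
    intro x hx y hy
    have h1 := h x hx y hy
    have h2 := norm_sub_norm_le ((x - y) • v) ((x - y) • v - (f x - f y))
    rw [sub_sub_cancel, norm_smul, norm_sub_rev ((x - y) • v)] at h2
    simp only [ContinuousLinearMap.toSpanSingleton_apply] at h1
    rw [NNReal.coe_sub hv.le, dist_eq_norm, dist_eq_norm, coe_nnnorm]
    nlinarith
  have hinj : InjOn f s := by
    intro x hx y hy hxy
    have := key x hx y hy
    rw [hxy, dist_self] at this
    exact dist_le_zero.1 (nonpos_of_mul_nonpos_right this hpos)
  have hl : LipschitzOnWith (‖v‖₊ - δ)⁻¹ (Function.invFunOn f s) (f '' s) := by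
    refine LipschitzOnWith.of_dist_le_mul ?_
    rintro _ ⟨x, hx, rfl⟩ _ ⟨y, hy, rfl⟩
    rw [hinj.leftInvOn_invFunOn hx, hinj.leftInvOn_invFunOn hy, NNReal.coe_inv,
      inv_mul_eq_div, le_div_iff₀ (by exact_mod_cast hpos), mul_comm]
    exact key x hx y hy
  have := hl.hausdorffMeasure_image_le (d := 1) zero_le_one
  rw [hinj.leftInvOn_invFunOn.image_image, hausdorffMeasure_real, ENNReal.rpow_one,
    ENNReal.coe_inv hpos.ne'] at this
  rw [mul_comm, ← ENNReal.le_div_iff_mul_le (Or.inl (by exact_mod_cast hpos.ne'))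
    (Or.inl ENNReal.coe_ne_top), ENNReal.div_eq_inv_mul]
  exact this

variable [SecondCountableTopology F]

theorem hausdorffMeasure_image_le_of_nnnorm_deriv_le {f v : ℝ → F} {s : Set ℝ}
    (hs : MeasurableSet s) (hfin : volume s ≠ ∞) (hf : ∀ x ∈ s, HasDerivAt f (v x) x) {M : ℝ≥0}
    (hM : ∀ x ∈ s, ‖v x‖₊ ≤ M) : μH[1] (f '' s) ≤ M * volume s := by
  rcases s.eq_empty_or_nonempty with rfl | hne
  · simp
  have step : ∀ δ : ℝ≥0, 0 < δ → μH[1] (f '' s) ≤ ((M + δ : ℝ≥0) : ℝ≥0∞) * volume s := by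
    intro δ hδ
    obtain ⟨t, A, hdisj, hmeas, hcov, happ, hA⟩ :=
      exists_partition_approximatesLinearOn_of_hasFDerivWithinAt f s
        (fun x => ContinuousLinearMap.toSpanSingleton ℝ (v x))
        (fun x hx => (hf x hx).hasFDerivAt.hasFDerivWithinAt) (fun _ => δ) (fun _ => hδ.ne')
    have hsU : s = ⋃ n, s ∩ t n := by rw [← inter_iUnion, inter_eq_left.2 hcov]
    calc μH[1] (f '' s) = μH[1] (⋃ n, f '' (s ∩ t n)) := by rw [← image_iUnion, ← hsU]
      _ ≤ ∑' n, μH[1] (f '' (s ∩ t n)) := measure_iUnion_le _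
      _ ≤ ∑' n, ((M + δ : ℝ≥0) : ℝ≥0∞) * volume (s ∩ t n) := by
          refine ENNReal.tsum_le_tsum fun n => ?_
          refine (hausdorffMeasure_image_le_of_approximatesLinearOn (happ n)).trans ?_
          obtain ⟨y, hy, hAy⟩ := hA hne n
          gcongr
          rw [hAy, ContinuousLinearMap.nnnorm_toSpanSingleton]
          exact hM y hy
      _ = ((M + δ : ℝ≥0) : ℝ≥0∞) * volume s := by
          rw [ENNReal.tsum_mul_left, ← measure_iUnion
            (fun i j hij => (hdisj hij).mono inter_subset_right inter_subset_right)
            (fun n => hs.inter (hmeas n)), ← hsU]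
  have hlim : Tendsto (fun δ : ℝ≥0 => ((M + δ : ℝ≥0) : ℝ≥0∞) * volume s) (𝓝[>] 0)
      (𝓝 (M * volume s)) := by
    refine ENNReal.Tendsto.mul_const ?_ (Or.inr hfin)
    refine ENNReal.tendsto_coe.2 (Tendsto.mono_left ?_ nhdsWithin_le_nhds)
    exact (by fun_prop : Continuous fun δ : ℝ≥0 => M + δ).tendsto' _ _ (add_zero M)
  exact ge_of_tendsto hlim (eventually_mem_nhdsWithin.mono step)

theorem le_hausdorffMeasure_image_of_le_nnnorm_deriv {f v : ℝ → F} {s : Set ℝ}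
    (hs : MeasurableSet s) (hfin : volume s ≠ ∞) (hinj : InjOn f s)
    (hf : ∀ x ∈ s, HasDerivAt f (v x) x) {m : ℝ≥0} (hm : ∀ x ∈ s, m ≤ ‖v x‖₊) :
    m * volume s ≤ μH[1] (f '' s) := by
  rcases s.eq_empty_or_nonempty with rfl | hne
  · simp
  have hcont : ContinuousOn f s := fun x hx => (hf x hx).continuousAt.continuousWithinAt
  have step : ∀ δ : ℝ≥0, 0 < δ → ((m - δ : ℝ≥0) : ℝ≥0∞) * volume s ≤ μH[1] (f '' s) := by
    intro δ hδ
    obtain ⟨t, A, hdisj, hmeas, hcov, happ, hA⟩ :=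
      exists_partition_approximatesLinearOn_of_hasFDerivWithinAt f s
        (fun x => ContinuousLinearMap.toSpanSingleton ℝ (v x))
        (fun x hx => (hf x hx).hasFDerivAt.hasFDerivWithinAt) (fun _ => δ) (fun _ => hδ.ne')
    have hsU : s = ⋃ n, s ∩ t n := by rw [← inter_iUnion, inter_eq_left.2 hcov]
    have hdisj' : Pairwise (Function.onFun Disjoint fun n => s ∩ t n) :=
      fun i j hij => (hdisj hij).mono inter_subset_right inter_subset_right
    calc ((m - δ : ℝ≥0) : ℝ≥0∞) * volume s
        = ∑' n, ((m - δ : ℝ≥0) : ℝ≥0∞) * volume (s ∩ t n) := by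
          rw [ENNReal.tsum_mul_left, ← measure_iUnion hdisj' (fun n => hs.inter (hmeas n)), ← hsU]
      _ ≤ ∑' n, μH[1] (f '' (s ∩ t n)) := by
          refine ENNReal.tsum_le_tsum fun n => ?_
          obtain ⟨y, hy, hAy⟩ := hA hne n
          refine le_trans ?_ (le_hausdorffMeasure_image_of_approximatesLinearOn (hAy ▸ happ n))
          gcongr
          exact hm y hy
      _ = μH[1] (⋃ n, f '' (s ∩ t n)) := by
          refine (measure_iUnion (fun i j hij => ?_) fun n => ?_).symm
          · exact (hdisj' hij).image hinj inter_subset_left inter_subset_left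
          · exact (hs.inter (hmeas n)).image_of_continuousOn_injOn (hcont.mono inter_subset_left)
              (hinj.mono inter_subset_left)
      _ = μH[1] (f '' s) := by rw [← image_iUnion, ← hsU]
  have hlim : Tendsto (fun δ : ℝ≥0 => ((m - δ : ℝ≥0) : ℝ≥0∞) * volume s) (𝓝[>] 0)
      (𝓝 (m * volume s)) := by
    refine ENNReal.Tendsto.mul_const ?_ (Or.inr hfin)
    refine ENNReal.tendsto_coe.2 (Tendsto.mono_left ?_ nhdsWithin_le_nhds)
    exact (by fun_prop : Continuous fun δ : ℝ≥0 => m - δ).tendsto' _ _ (tsub_zero m)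
  exact le_of_tendsto hlim (eventually_mem_nhdsWithin.mono step)

/-- Area formula for an injective integral curve of a non-vanishing Borel field `b`, with the
weight `1/|b|`. -/
theorem lintegral_image_inv_nnnorm_eq_volume {f : ℝ → F} {b : F → F} (hb : Measurable b)
    (hfm : Measurable f) {s : Set ℝ}
    (hs : MeasurableSet s) (hfin : volume s ≠ ∞) (hinj : InjOn f s)
    (hf : ∀ x ∈ s, HasDerivAt f (b (f x)) x) (hne : ∀ x ∈ s, b (f x) ≠ 0) :
    ∫⁻ w in f '' s, (‖b w‖₊⁻¹ : ℝ≥0) ∂μH[1] = volume s := by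
  have hcont : ContinuousOn f s := fun x hx => (hf x hx).continuousAt.continuousWithinAt
  have bounds : ∀ c : ℝ≥0, 1 < c →
      ∫⁻ w in f '' s, (‖b w‖₊⁻¹ : ℝ≥0) ∂μH[1] ≤ c * volume s ∧
        volume s ≤ c * ∫⁻ w in f '' s, (‖b w‖₊⁻¹ : ℝ≥0) ∂μH[1] := by
    intro c hc
    have hc0 : 0 < c := zero_lt_one.trans hc
    set B : ℤ → Set F := fun k => {w | ‖b w‖₊ ∈ Ico (c ^ k) (c ^ (k + 1))} with hB
    set P : ℤ → Set ℝ := fun k => s ∩ f ⁻¹' B k with hP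
    have hBm : ∀ k, MeasurableSet (B k) := fun k => hb.nnnorm measurableSet_Ico
    have hPm : ∀ k, MeasurableSet (P k) := fun k => hs.inter (hfm (hBm k))
    have hPs : ∀ k, P k ⊆ s := fun k => inter_subset_left
    have hPd : Pairwise (Function.onFun Disjoint P) := by
      intro i j hij
      refine Set.disjoint_left.2 fun x hxi hxj => hij ?_
      have h1 := hxi.2.1.trans_lt hxj.2.2
      have h2 := hxj.2.1.trans_lt hxi.2.2
      rw [zpow_lt_zpow_iff_right₀ hc] at h1 h2
      omega
    have hsU : s = ⋃ k, P k := by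
      refine subset_antisymm (fun x hx => ?_) (iUnion_subset hPs)
      obtain ⟨k, hk⟩ := exists_mem_Ico_zpow (nnnorm_pos.2 (hne x hx)) hc
      exact mem_iUnion.2 ⟨k, hx, hk⟩
    have hIm : ∀ k, MeasurableSet (f '' P k) := fun k =>
      (hPm k).image_of_continuousOn_injOn (hcont.mono (hPs k)) (hinj.mono (hPs k))
    have hvol : volume s = ∑' k, volume (P k) := by
      rw [← measure_iUnion hPd hPm, ← hsU]
    have hlint : ∫⁻ w in f '' s, (‖b w‖₊⁻¹ : ℝ≥0) ∂μH[1]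
        = ∑' k, ∫⁻ w in f '' P k, (‖b w‖₊⁻¹ : ℝ≥0) ∂μH[1] := by
      rw [← lintegral_iUnion hIm, ← image_iUnion, ← hsU]
      exact fun i j hij => (hPd hij).image hinj (hPs i) (hPs j)
    have hck : ∀ k : ℤ, 0 < c ^ k := fun k => zpow_pos hc0 k
    rw [hvol, hlint, ← ENNReal.tsum_mul_left, ← ENNReal.tsum_mul_left]
    refine ⟨ENNReal.tsum_le_tsum fun k => ?_, ENNReal.tsum_le_tsum fun k => ?_⟩
    · calc ∫⁻ w in f '' P k, (‖b w‖₊⁻¹ : ℝ≥0) ∂μH[1]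
          ≤ ∫⁻ _ in f '' P k, ((c ^ k)⁻¹ : ℝ≥0) ∂μH[1] := by
            refine setLIntegral_mono' (hIm k) ?_
            rintro _ ⟨x, hx, rfl⟩
            exact ENNReal.coe_le_coe.2 (inv_anti₀ (hck k) hx.2.1)
        _ = ((c ^ k)⁻¹ : ℝ≥0) * μH[1] (f '' P k) := by rw [setLIntegral_const]
        _ ≤ ((c ^ k)⁻¹ : ℝ≥0) * ((c ^ (k + 1) : ℝ≥0) * volume (P k)) := by
            gcongr
            exact hausdorffMeasure_image_le_of_nnnorm_deriv_le (hPm k)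
              (measure_ne_top_of_subset (hPs k) hfin) (fun x hx => hf x hx.1)
              (fun x hx => hx.2.2.le)
        _ = c * volume (P k) := by
            rw [← mul_assoc, ← ENNReal.coe_mul, zpow_add_one₀ hc0.ne',
              inv_mul_cancel_left₀ (hck k).ne']
    · calc volume (P k)
          = c * (((c ^ (k + 1))⁻¹ : ℝ≥0) * ((c ^ k : ℝ≥0) * volume (P k))) := by
            rw [← mul_assoc, ← mul_assoc, ← ENNReal.coe_mul, ← ENNReal.coe_mul,
              zpow_add_one₀ hc0.ne']
            have h1 : c * (c ^ k * c)⁻¹ * c ^ k = 1 := by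
              have := hc0.ne'
              field_simp
            rw [h1, ENNReal.coe_one, one_mul]
        _ ≤ c * (((c ^ (k + 1))⁻¹ : ℝ≥0) * μH[1] (f '' P k)) := by
            gcongr
            exact le_hausdorffMeasure_image_of_le_nnnorm_deriv (hPm k)
              (measure_ne_top_of_subset (hPs k) hfin) (hinj.mono (hPs k))
              (fun x hx => hf x hx.1) (fun x hx => hx.2.1)
        _ = c * ∫⁻ _ in f '' P k, ((c ^ (k + 1))⁻¹ : ℝ≥0) ∂μH[1] := by rw [setLIntegral_const]
        _ ≤ c * ∫⁻ w in f '' P k, (‖b w‖₊⁻¹ : ℝ≥0) ∂μH[1] := by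
            refine mul_le_mul' le_rfl (setLIntegral_mono' (hIm k) ?_)
            rintro _ ⟨x, hx, rfl⟩
            exact ENNReal.coe_le_coe.2 (inv_anti₀ (nnnorm_pos.2 (hne x hx.1)) hx.2.2.le)
  have hlim : ∀ a : ℝ≥0∞, a ≠ ∞ → Tendsto (fun c : ℝ≥0 => (c : ℝ≥0∞) * a) (𝓝[>] 1) (𝓝 a) := by
    intro a ha
    have : Tendsto (fun c : ℝ≥0 => (c : ℝ≥0∞) * a) (𝓝[>] 1) (𝓝 ((1 : ℝ≥0) * a)) :=
      ENNReal.Tendsto.mul_const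
        (ENNReal.tendsto_coe.2 (tendsto_id.mono_left nhdsWithin_le_nhds)) (Or.inr ha)
    simpa using this
  have hle : ∫⁻ w in f '' s, (‖b w‖₊⁻¹ : ℝ≥0) ∂μH[1] ≤ volume s :=
    ge_of_tendsto (hlim _ hfin) (eventually_mem_nhdsWithin.mono fun c hc => (bounds c hc).1)
  exact le_antisymm hle (ge_of_tendsto (hlim _ (hle.trans_lt hfin.lt_top).ne)
    (eventually_mem_nhdsWithin.mono fun c hc => (bounds c hc).2))

end AreaFormula

section Monotone

variable {F : Type*} [NormedAddCommGroup F] [InnerProductSpace ℝ F]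

theorem measure_setOf_mem_not_eq_zero {X : Type*} [MeasurableSpace X] {μ : Measure X} {s : Set X}
    (hs : MeasurableSet s) {p : X → Prop} (h : ∀ᵐ x ∂μ.restrict s, p x) :
    μ {x ∈ s | ¬ p x} = 0 := by
  have := (ae_restrict_iff' hs).1 h
  rw [ae_iff] at this
  simpa only [Classical.not_imp] using this

theorem LipschitzWith.hausdorffMeasure_image_eq_zero {X Y : Type*} [EMetricSpace X]
    [EMetricSpace Y] [MeasurableSpace X] [BorelSpace X] [MeasurableSpace Y] [BorelSpace Y]
    {K : ℝ≥0} {f : X → Y} (hf : LipschitzWith K f) {s : Set X} (hs : μH[1] s = 0) :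
    μH[1] (f '' s) = 0 := by
  simpa [hs] using hf.hausdorffMeasure_image_le (d := 1) zero_le_one s

theorem hausdorffMeasure_image_Icc_ne_zero {X : Type*} [MetricSpace X] [MeasurableSpace X]
    [BorelSpace X] {g : ℝ → X} {a c : ℝ} (hac : a ≤ c) (hg : ContinuousOn g (Icc a c))
    (hne : g a ≠ g c) : μH[1] (g '' Icc a c) ≠ 0 := by
  intro h0
  have h1 := (LipschitzWith.dist_right (g a)).hausdorffMeasure_image_eq_zero h0
  have hsub := intermediate_value_Icc hac
    ((LipschitzWith.dist_right (g a)).continuous.comp_continuousOn hg)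
  rw [← image_comp, hausdorffMeasure_real] at h1
  have h2 := measure_mono_null hsub h1
  simp only [Function.comp_apply, dist_self, Real.volume_Icc, sub_zero,
    ENNReal.ofReal_eq_zero] at h2
  exact hne (dist_le_zero.1 h2)

theorem exists_hasDerivAt_ne_zero_notMem {F : Type*} [NormedAddCommGroup F] [NormedSpace ℝ F]
    [CompleteSpace F] [MeasurableSpace F] [BorelSpace F] [SecondCountableTopology F]
    {g : ℝ → F} {b : F → F} {K : ℝ≥0} (hg : LipschitzWith K g)
    {a c : ℝ} (hac : a ≤ c) (hne : g a ≠ g c)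
    (hode : ∀ᵐ t ∂volume.restrict (Icc a c), HasDerivAt g (b (g t)) t)
    {N : Set F} (hN : μH[1] N = 0) :
    ∃ s ∈ Icc a c, HasDerivAt g (b (g s)) s ∧ b (g s) ≠ 0 ∧ g s ∉ N := by
  by_contra! hcon
  set S : Set ℝ := {s ∈ Icc a c | ¬ HasDerivAt g (b (g s)) s}
  set Z : Set ℝ := Icc a c ∩ {s | DifferentiableAt ℝ g s} ∩ {s | deriv g s = 0}
  have hS : volume S = 0 := measure_setOf_mem_not_eq_zero measurableSet_Icc hode
  have hZ : μH[1] (g '' Z) = 0 := by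
    have hZm : MeasurableSet Z :=
      (measurableSet_Icc.inter (measurableSet_of_differentiableAt ℝ g)).inter
        (measurable_deriv g (measurableSet_singleton 0))
    have := hausdorffMeasure_image_le_of_nnnorm_deriv_le (f := g) (v := deriv g) (M := 0) hZm
      (measure_ne_top_of_subset (fun x hx => hx.1.1) measure_Icc_lt_top.ne)
      (fun x hx => hx.1.2.hasDerivAt) (fun x hx => by simp [show deriv g x = 0 from hx.2])
    simpa using this
  refine hausdorffMeasure_image_Icc_ne_zero hac hg.continuous.continuousOn hne ?_
  refine measure_mono_null (t := g '' S ∪ g '' Z ∪ N) ?_ (measure_union_null (measure_union_null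
    (hg.hausdorffMeasure_image_eq_zero (by rwa [hausdorffMeasure_real])) hZ) hN)
  rintro _ ⟨s, hs, rfl⟩
  by_cases hd : HasDerivAt g (b (g s)) s
  · by_cases hz : b (g s) = 0
    · exact Or.inl (Or.inr ⟨s, ⟨⟨hs, hd.differentiableAt⟩, hd.deriv.trans hz⟩, rfl⟩)
    · exact Or.inr (hcon s hs hd hz)
  · exact Or.inl (Or.inl ⟨s, ⟨hs, hd⟩, rfl⟩)

theorem eventually_inner_pos_of_hasDerivAt {f : ℝ → F} {v : F} {x : ℝ} (hf : HasDerivAt f v x)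
    (hv : v ≠ 0) : ∀ᶠ y in 𝓝[≠] x, 0 < (y - x) * inner ℝ v (f y - f x) := by
  have h := ((innerSL ℝ v).hasFDerivAt.comp_hasDerivAt x hf).tendsto_slope
  have h0 : 0 < innerSL ℝ v v := real_inner_self_pos.2 hv
  filter_upwards [h.eventually (lt_mem_nhds h0), self_mem_nhdsWithin] with y hy hyx
  have hyx' : y - x ≠ 0 := sub_ne_zero.2 hyx
  rw [slope_def_field] at hy
  simp only [Function.comp_apply, innerSL_apply_apply, ← inner_sub_right] at hy
  have := mul_pos hy (mul_self_pos.2 hyx')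
  field_simp at this
  linarith

/-- If `f = g ∘ φ` runs inside an injective integral curve `g` of `b` and is itself an integral
curve of `b`, then the reparametrization `φ` cannot go backwards. -/
theorem monotoneOn_reparametrization [CompleteSpace F] [MeasurableSpace F] [BorelSpace F]
    [SecondCountableTopology F] {f g : ℝ → F} {b : F → F} {K K' : ℝ≥0} {φ : ℝ → ℝ} {a c : ℝ}
    (hf : LipschitzWith K f) (hg : LipschitzWith K' g)
    (hfode : ∀ᵐ t ∂volume.restrict (Icc a c), HasDerivAt f (b (f t)) t)
    (hgode : ∀ᵐ t ∂volume.restrict (Icc a c), HasDerivAt g (b (g t)) t)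
    (hginj : InjOn g (Icc a c)) (hφ : ContinuousOn φ (Icc a c))
    (hmaps : MapsTo φ (Icc a c) (Icc a c)) (hfg : ∀ t ∈ Icc a c, g (φ t) = f t) :
    MonotoneOn φ (Icc a c) := by
  intro t₁ ht₁ t₂ ht₂ h12
  by_contra! hlt
  set N : Set ℝ := {t ∈ Icc a c | ¬ HasDerivAt f (b (f t)) t}
  have hN : volume N = 0 := measure_setOf_mem_not_eq_zero measurableSet_Icc hfode
  obtain ⟨s₀, h0, h0'⟩ := exists_between hlt
  obtain ⟨s₁, h1, h1'⟩ := exists_between h0'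
  have hsub : Icc s₀ s₁ ⊆ Icc a c :=
    Icc_subset_Icc ((hmaps ht₂).1.trans h0.le) (h1'.le.trans (hmaps ht₁).2)
  obtain ⟨s, hs, hgs, hbs, hsN⟩ := exists_hasDerivAt_ne_zero_notMem hg h1.le
    (fun h => h1.ne (hginj (hsub ⟨le_rfl, h1.le⟩) (hsub ⟨h1.le, le_rfl⟩) h))
    (ae_restrict_of_ae_restrict_of_subset hsub hgode)
    (hf.hausdorffMeasure_image_eq_zero (s := N) (by rwa [hausdorffMeasure_real]))
  have hsub12 : Icc t₁ t₂ ⊆ Icc a c := Icc_subset_Icc ht₁.1 ht₂.2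
  have hcpt : IsCompact (Icc t₁ t₂ ∩ φ ⁻¹' Iic s) :=
    isCompact_Icc.of_isClosed_subset
      ((hφ.mono hsub12).preimage_isClosed_of_isClosed isClosed_Icc isClosed_Iic) inter_subset_left
  obtain ⟨τ, ⟨hτ, hτs⟩, hmin⟩ := hcpt.exists_isLeast ⟨t₂, ⟨h12, le_rfl⟩, h0.le.trans hs.1⟩
  have hbefore : ∀ t ∈ Ico t₁ τ, s < φ t := fun t ht => by
    by_contra! h
    exact ht.2.not_ge (hmin ⟨⟨ht.1, ht.2.le.trans hτ.2⟩, h⟩)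
  have ht₁τ : t₁ < τ := hτ.1.lt_of_ne (by rintro rfl; exact (hs.2.trans_lt h1').not_ge hτs)
  have hφτ : Tendsto φ (𝓝[<] τ) (𝓝 (φ τ)) := by
    refine (hφ τ (hsub12 hτ)).mono_left ?_
    rw [← nhdsWithin_Ico_eq_nhdsLT ht₁τ]
    exact nhdsWithin_mono _ (fun t ht => hsub12 ⟨ht.1, ht.2.le.trans hτ.2⟩)
  have hev : ∀ᶠ t in 𝓝[<] τ, t ∈ Ico t₁ τ := Ico_mem_nhdsLT ht₁τ
  have hφs : φ τ = s := le_antisymm hτs (ge_of_tendsto hφτ (hev.mono fun t ht => (hbefore t ht).le))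
  have hfτ : f τ = g s := by rw [← hfg τ (hsub12 hτ), hφs]
  have hfd : HasDerivAt f (b (g s)) τ := by
    by_contra h
    exact hsN ⟨τ, ⟨hsub12 hτ, by rwa [hfτ]⟩, hfτ⟩
  have hφτ' : Tendsto φ (𝓝[<] τ) (𝓝[≠] s) :=
    tendsto_nhdsWithin_iff.2 ⟨hφs ▸ hφτ, hev.mono fun t ht => (hbefore t ht).ne'⟩
  have e1 := (eventually_inner_pos_of_hasDerivAt hfd hbs).filter_mono (nhdsLT_le_nhdsNE τ)
  have e2 := hφτ'.eventually (eventually_inner_pos_of_hasDerivAt hgs hbs)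
  obtain ⟨t, ht, p1, p2⟩ := (hev.and (e1.and e2)).exists
  rw [hfg t (hsub12 ⟨ht.1, ht.2.le.trans hτ.2⟩)] at p2
  rw [hfτ] at p1
  have n1 := sub_neg.2 ht.2
  have n2 := sub_pos.2 (hbefore t ht)
  nlinarith [(mul_pos_iff_of_pos_left n2).1 p2]

end Monotone

theorem continuousOn_invFunOn_image {X Y : Type*} [TopologicalSpace X] [TopologicalSpace Y]
    [T2Space Y] [Nonempty X] {g : X → Y} {s : Set X} (hs : IsCompact s) (hg : ContinuousOn g s)
    (hinj : InjOn g s) : ContinuousOn (Function.invFunOn g s) (g '' s) := by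
  rw [continuousOn_iff_isClosed]
  intro t ht
  refine ⟨g '' (s ∩ t), ((hs.inter_right ht).image_of_continuousOn
    (hg.mono inter_subset_left)).isClosed, ?_⟩
  ext y
  constructor
  · rintro ⟨hy, x, hx, rfl⟩
    rw [mem_preimage, hinj.leftInvOn_invFunOn hx] at hy
    exact ⟨⟨x, ⟨hx, hy⟩, rfl⟩, x, hx, rfl⟩
  · rintro ⟨⟨x, hx, rfl⟩, hy⟩
    exact ⟨by rw [mem_preimage, hinj.leftInvOn_invFunOn hx.1]; exact hx.2, hy⟩

theorem injOn_of_monotoneOn_reparametrization {F : Type*} [NormedAddCommGroup F] [NormedSpace ℝ F]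
    {f g v : ℝ → F} {φ : ℝ → ℝ} {a c : ℝ}
    (hφ : MonotoneOn φ (Icc a c)) (hmaps : MapsTo φ (Icc a c) (Icc a c))
    (hginj : InjOn g (Icc a c)) (hfg : ∀ t ∈ Icc a c, g (φ t) = f t) :
    InjOn f {t ∈ Icc a c | HasDerivAt f (v t) t ∧ v t ≠ 0} := by
  have key : ∀ x ∈ Icc a c, ∀ y ∈ Icc a c, HasDerivAt f (v x) x → v x ≠ 0 → f x = f y →
      ¬ x < y := by
    intro x hx y hy hd hv hxy hlt
    have hφxy : φ x = φ y := hginj (hmaps hx) (hmaps hy) (by rw [hfg x hx, hfg y hy, hxy])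
    have hconst : ∀ t ∈ Icc x y, f t = f x := by
      intro t ht
      have htI : t ∈ Icc a c := ⟨hx.1.trans ht.1, ht.2.trans hy.2⟩
      have : φ t = φ x := le_antisymm (hφxy ▸ hφ htI hy ht.2) (hφ hx htI ht.1)
      rw [← hfg t htI, this, hfg x hx]
    refine hv ((uniqueDiffOn_Icc hlt x ⟨le_rfl, hlt.le⟩).eq_deriv _ hd.hasDerivWithinAt ?_)
    exact (hasDerivWithinAt_const x _ (f x)).congr hconst rfl
  intro x hx y hy hxy
  rcases lt_trichotomy x y with h | h | h
  · exact (key x hx.1 y hy.1 hx.2.1 hx.2.2 hxy h).elim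
  · exact h
  · exact (key y hy.1 x hx.1 hy.2.1 hy.2.2 hxy.symm h).elim

/-- Let `γ` be a Lipschitz integral curve of a Borel field `b` on `[0,T]`
contained in the image of an injective Lipschitz integral curve `ĝ`, with
`1/|b| ∈ L¹(H¹⌞γ([0,T]))`. Then for all `0 ≤ t₀ ≤ t ≤ T`,
`∫_{γ((t₀,t))} dH¹(w)/|b(w)| = (t − t₀) − L¹({τ ∈ (t₀,t) : γ'(τ) = 0})`. -/
theorem stmt18 (T : ℝ) (hT : 0 < T)
    (b : E2 → E2) (hb : Measurable b)
    (γ g : ℝ → E2) (K K' : NNReal)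
    (hγl : LipschitzWith K γ) (hgl : LipschitzWith K' g)
    (hγode : ∀ᵐ t ∂(volume.restrict (Set.Icc 0 T)), HasDerivAt γ (b (γ t)) t)
    (hgode : ∀ᵐ t ∂(volume.restrict (Set.Icc 0 T)), HasDerivAt g (b (g t)) t)
    (hginj : Set.InjOn g (Set.Icc 0 T))
    (himg : γ '' Set.Icc 0 T ⊆ g '' Set.Icc 0 T)
    (hint : Integrable (fun w => ‖b w‖⁻¹) (μH[1].restrict (γ '' Set.Icc 0 T))) :
    ∀ t₀ t : ℝ, 0 ≤ t₀ → t₀ ≤ t → t ≤ T →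
      (∫ w in γ '' Set.Ioo t₀ t, ‖b w‖⁻¹ ∂μH[1]) =
        (t - t₀) - (volume {τ ∈ Set.Ioo t₀ t | HasDerivAt γ 0 τ}).toReal := by
  intro t₀ t h0 h01 h1
  have hsub : Ioo t₀ t ⊆ Icc 0 T := fun x hx => ⟨h0.trans hx.1.le, hx.2.le.trans h1⟩
  set φ : ℝ → ℝ := Function.invFunOn g (Icc 0 T) ∘ γ
  have hmem : ∀ x ∈ Icc 0 T, γ x ∈ g '' Icc 0 T := fun x hx => himg (mem_image_of_mem γ hx)
  have hφc : ContinuousOn φ (Icc 0 T) :=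
    (continuousOn_invFunOn_image isCompact_Icc hgl.continuous.continuousOn hginj).comp
      hγl.continuous.continuousOn hmem
  have hmaps : MapsTo φ (Icc 0 T) (Icc 0 T) := fun x hx => Function.invFunOn_mem (hmem x hx)
  have hfg : ∀ x ∈ Icc 0 T, g (φ x) = γ x := fun x hx => Function.invFunOn_eq (hmem x hx)
  have hmono := monotoneOn_reparametrization hγl hgl hγode hgode hginj hφc hmaps hfg
  set D : Set ℝ := {x ∈ Ioo t₀ t | HasDerivAt γ (b (γ x)) x ∧ b (γ x) ≠ 0}
  set Z : Set ℝ := {x ∈ Ioo t₀ t | HasDerivAt γ 0 x}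
  set N : Set ℝ := {x ∈ Icc 0 T | ¬ HasDerivAt γ (b (γ x)) x}
  have hNnull : volume N = 0 := measure_setOf_mem_not_eq_zero measurableSet_Icc hγode
  have hbγ : Measurable fun x => b (γ x) := hb.comp hγl.continuous.measurable
  have hderiv : ∀ v : ℝ → E2, Measurable v → MeasurableSet {x | HasDerivAt γ (v x) x} := by
    intro v hv
    have : {x | HasDerivAt γ (v x) x} = {x | DifferentiableAt ℝ γ x} ∩ {x | deriv γ x = v x} := by
      ext x
      refine ⟨fun h => ⟨h.differentiableAt, h.deriv⟩, fun ⟨hd, hv⟩ => ?_⟩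
      rw [mem_ofPred_eq] at hd hv ⊢
      exact hv ▸ hd.hasDerivAt
    rw [this]
    exact (measurableSet_of_differentiableAt ℝ γ).inter
      (measurableSet_eq_fun (measurable_deriv γ) hv)
  have hDm : MeasurableSet D := measurableSet_Ioo.inter
    ((hderiv _ hbγ).inter (hbγ (measurableSet_singleton 0).compl))
  have hZm : MeasurableSet Z := measurableSet_Ioo.inter (hderiv _ measurable_const)
  have hDinj : InjOn γ D := by
    refine (injOn_of_monotoneOn_reparametrization (v := fun x => b (γ x))
      hmono hmaps hginj hfg).mono ?_
    exact fun x hx => ⟨hsub hx.1, hx.2⟩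
  have hDtop : volume D ≠ ∞ :=
    measure_ne_top_of_subset (sep_subset _ _) measure_Ioo_lt_top.ne
  have hZtop : volume Z ≠ ∞ :=
    measure_ne_top_of_subset (sep_subset _ _) measure_Ioo_lt_top.ne
  have hDγ : MeasurableSet (γ '' D) :=
    hDm.image_of_continuousOn_injOn hγl.continuous.continuousOn hDinj
  have harea := lintegral_image_inv_nnnorm_eq_volume hb hγl.continuous.measurable hDm hDtop hDinj
    (fun x hx => hx.2.1) (fun x hx => hx.2.2)
  have hvol : volume D + volume Z = ENNReal.ofReal (t - t₀) := by
    have hdisj : Disjoint D Z := Set.disjoint_left.2 fun x ⟨_, hd, hne⟩ ⟨_, hz⟩ =>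
      hne (hd.unique hz)
    rw [← measure_union hdisj hZm, ← Real.volume_Ioo]
    refine le_antisymm (measure_mono (union_subset (sep_subset _ _) (sep_subset _ _))) ?_
    calc volume (Ioo t₀ t) ≤ volume ((D ∪ Z) ∪ N) := measure_mono fun x hx => by
          by_cases hd : HasDerivAt γ (b (γ x)) x
          · by_cases hz : b (γ x) = 0
            · exact Or.inl (Or.inr ⟨hx, hz ▸ hd⟩)
            · exact Or.inl (Or.inl ⟨hx, hd, hz⟩)
          · exact Or.inr ⟨hsub hx, hd⟩
      _ ≤ volume (D ∪ Z) + volume N := measure_union_le _ _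
      _ = volume (D ∪ Z) := by rw [hNnull, add_zero]
  have hNγ : μH[1] (γ '' N) = 0 :=
    hγl.hausdorffMeasure_image_eq_zero (by rwa [hausdorffMeasure_real])
  have hset : ∫ w in γ '' Ioo t₀ t, ‖b w‖⁻¹ ∂μH[1] = ∫ w in γ '' D, ‖b w‖⁻¹ ∂μH[1] := by
    refine setIntegral_eq_of_subset_of_ae_sdiff_eq_zero ?_ (image_mono (sep_subset _ _)) ?_
    · obtain ⟨C, hC, hCsub, hCU, -⟩ := (isOpen_Ioo (a := t₀) (b := t)).exists_iUnion_isClosed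
      rw [← hCU, image_iUnion]
      refine (MeasurableSet.iUnion fun n => IsCompact.measurableSet ?_).nullMeasurableSet
      exact (isCompact_Icc.of_isClosed_subset (hC n) ((hCsub n).trans hsub)).image hγl.continuous
    · filter_upwards [measure_eq_zero_iff_ae_notMem.1 hNγ] with w hw hwD
      obtain ⟨⟨x, hx, rfl⟩, hxD⟩ := hwD
      by_contra hne
      have hbx : b (γ x) ≠ 0 := fun h => hne (by simp [h])
      have hd : HasDerivAt γ (b (γ x)) x := by
        by_contra hd
        exact hw ⟨x, ⟨hsub hx, hd⟩, rfl⟩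
      exact hxD ⟨x, ⟨hx, hd, hbx⟩, rfl⟩
  have hval : ∫ w in γ '' D, ‖b w‖⁻¹ ∂μH[1] = (volume D).toReal := by
    rw [integral_eq_lintegral_of_nonneg_ae (ae_of_all _ fun w => inv_nonneg.2 (norm_nonneg _))
      (show Measurable fun w => ‖b w‖⁻¹ from hb.norm.inv).aestronglyMeasurable, ← harea]
    congr 1
    refine lintegral_congr fun w => ?_
    rw [← coe_nnnorm, ← NNReal.coe_inv, ENNReal.ofReal_coe_nnreal]
  rw [hset, hval, eq_sub_iff_add_eq, ← ENNReal.toReal_add hDtop hZtop, hvol,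
    ENNReal.toReal_ofReal (sub_nonneg.2 h01)]
end
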